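/- Let n > 6 and let m = n + p(n−4) + q(n−2) for some integers p ≥ 1 and q ≥ 0. Then there exists a map F : A_{C_m} → A_{C_n} that is (p+2q+2)-Lipschitz with respect to the word metrics and satisfies d(F(g₁), F(g₂)) ≥ d(g₁, g₂) − (2p+4q) for all g₁, g₂ ∈ A_{C_m}; in particular, F is a quasiisometric embedding. -/

import Mathlib

open scoped symmDiff

/-- The commutation relations defining the right-angled Artin group of a simple graph. -/
def raagRels {V : Type*} (Γ : SimpleGraph V) : Set (FreeGroup V) :=
  {r | ∃ v w, Γ.Adj v w ∧
    r = FreeGroup.of v * FreeGroup.of w * (FreeGroup.of v)⁻¹ * (FreeGroup.of w)⁻¹}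

/-- The right-angled Artin group of a simple graph. -/
abbrev RAAG {V : Type*} (Γ : SimpleGraph V) : Type _ :=
  PresentedGroup (raagRels Γ)

/-- The standard generating set of a right-angled Artin group. -/
def raagGen {V : Type*} (Γ : SimpleGraph V) : Set (RAAG Γ) :=
  Set.range (fun v : V => (PresentedGroup.of v : RAAG Γ))

/-- The word length of a group element with respect to a set `S`: the least length of a
word in elements of `S` and their inverses representing the element. -/
noncomputable def wordLength {G : Type*} [Group G] (S : Set G) (g : G) : ℕ :=
  sInf {k | ∃ w : List G, w.length = k ∧ (∀ x ∈ w, x ∈ S ∨ x⁻¹ ∈ S) ∧ w.prod = g}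

/-- The word metric associated with a generating set `S`. -/
noncomputable def wordDist {G : Type*} [Group G] (S : Set G) (g h : G) : ℝ :=
  (wordLength S (g⁻¹ * h) : ℝ)

/-- `f` is a quasiisometric embedding with respect to distance functions `dX`, `dY`. -/
def IsQIEWith {X Y : Type*} (dX : X → X → ℝ) (dY : Y → Y → ℝ) (f : X → Y) : Prop :=
  ∃ K A : ℝ, 1 ≤ K ∧ 0 ≤ A ∧ ∀ x x' : X,
    (1 / K) * dX x x' - A ≤ dY (f x) (f x') ∧ dY (f x) (f x') ≤ K * dX x x' + A

/-- The cycle graph on `n` vertices, with vertex set `ZMod n`. -/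
def cycleGraph (n : ℕ) : SimpleGraph (ZMod n) :=
  SimpleGraph.fromRel (fun v w => w = v + 1)

namespace TraceWord

variable {V : Type*}

/-- A letter is a generator together with a sign; `true` stands for the generator itself. -/
abbrev Letter (V : Type*) := V × Bool

/-- The formal inverse of a letter. -/
def inv (s : Letter V) : Letter V := (s.1, !s.2)

@[simp] lemma inv_inv (s : Letter V) : inv (inv s) = s := by simp [inv]

/-- Words are stacks, the head being the last letter.  `StackTop G t w` says that `t` can be
shuffled to the top of `w`. -/
def StackTop (G : SimpleGraph V) (t : Letter V) : List (Letter V) → Prop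
  | [] => False
  | s :: w => s = t ∨ (G.Adj s.1 t.1 ∧ StackTop G t w)

/-- Reduced words. -/
def Reduced (G : SimpleGraph V) : List (Letter V) → Prop
  | [] => True
  | s :: w => Reduced G w ∧ ¬ StackTop G (inv s) w

/-- Two words differ by exchanges of adjacent commuting letters. -/
inductive Shuffle (G : SimpleGraph V) : List (Letter V) → List (Letter V) → Prop
  | refl (w) : Shuffle G w w
  | cons (s) {w w'} : Shuffle G w w' → Shuffle G (s :: w) (s :: w')
  | swap (s t w) : G.Adj s.1 t.1 → Shuffle G (s :: t :: w) (t :: s :: w)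
  | trans {w w' w''} : Shuffle G w w' → Shuffle G w' w'' → Shuffle G w w''

variable {G : SimpleGraph V}

lemma Shuffle.symm {w w' : List (Letter V)} (h : Shuffle G w w') : Shuffle G w' w := by
  induction h with
  | refl w => exact .refl w
  | cons s _ ih => exact .cons s ih
  | swap s t w h => exact .swap t s w h.symm
  | trans _ _ ih1 ih2 => exact ih2.trans ih1

lemma Shuffle.length_eq {w w' : List (Letter V)} (h : Shuffle G w w') :
    w.length = w'.length := by
  induction h with
  | refl w => rfl
  | cons s _ ih => simp [ih]
  | swap s t w h => simp
  | trans _ _ ih1 ih2 => exact ih1.trans ih2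

lemma Shuffle.append_right {w w' : List (Letter V)} (h : Shuffle G w w') (v : List (Letter V)) :
    Shuffle G (w ++ v) (w' ++ v) := by
  induction h with
  | refl w => exact .refl _
  | cons s _ ih => exact .cons s ih
  | swap s t w h => exact .swap s t _ h
  | trans _ _ ih1 ih2 => exact ih1.trans ih2

lemma Shuffle.append_left (v : List (Letter V)) {w w' : List (Letter V)} (h : Shuffle G w w') :
    Shuffle G (v ++ w) (v ++ w') := by
  induction v with
  | nil => exact h
  | cons s v ih => exact .cons s ih

lemma Shuffle.stackTop {w w' : List (Letter V)} (h : Shuffle G w w') {t : Letter V}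
    (ht : StackTop G t w) : StackTop G t w' := by
  induction h with
  | refl w => exact ht
  | cons s _ ih =>
    rcases ht with ht | ⟨h1, h2⟩
    · exact .inl ht
    · exact .inr ⟨h1, ih h2⟩
  | swap r s w h =>
    rcases ht with rfl | ⟨h1, rfl | ⟨h2, h3⟩⟩
    · exact .inr ⟨h.symm, .inl rfl⟩
    · exact .inl rfl
    · exact .inr ⟨h2, .inr ⟨h1, h3⟩⟩
  | trans _ _ ih1 ih2 => exact ih2 (ih1 ht)

lemma Shuffle.reduced {w w' : List (Letter V)} (h : Shuffle G w w')
    (hr : Reduced G w) : Reduced G w' := by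
  induction h with
  | refl w => exact hr
  | cons s h ih => exact ⟨ih hr.1, fun ht => hr.2 (h.symm.stackTop ht)⟩
  | swap r s w h =>
    obtain ⟨⟨h1, h2⟩, h3⟩ := hr
    refine ⟨⟨h1, fun ht => h3 (.inr ⟨h.symm, ht⟩)⟩, ?_⟩
    rintro (h4 | ⟨_, h4⟩)
    · have := congrArg Prod.fst h4
      exact h.ne this
    · exact h2 h4
  | trans _ _ ih1 ih2 => exact ih2 (ih1 hr)

lemma StackTop.exists_shuffle {t : Letter V} {w : List (Letter V)} (h : StackTop G t w) :
    ∃ w', Shuffle G w (t :: w') := by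
  induction w with
  | nil => exact h.elim
  | cons s w ih =>
    rcases h with rfl | ⟨h1, h2⟩
    · exact ⟨w, .refl _⟩
    · obtain ⟨w', hw'⟩ := ih h2
      exact ⟨s :: w', (Shuffle.cons s hw').trans (.swap s t w' h1)⟩

/-- Pilings: one stack of beads per vertex. -/
abbrev Piling (V : Type*) := V → List (Option Bool)

open Classical in
/-- Add a letter on top of a piling. -/
noncomputable def push (G : SimpleGraph V) (s : Letter V) (P : Piling V) : Piling V := fun x =>
  if x = s.1 then some s.2 :: P x else if G.Adj x s.1 then P x else none :: P x

open Classical in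
/-- Remove a letter from the top of a piling. -/
noncomputable def pop (G : SimpleGraph V) (s : Letter V) (P : Piling V) : Piling V := fun x =>
  if x = s.1 then (P x).tail else if G.Adj x s.1 then P x else (P x).tail

/-- The piling of a word. -/
noncomputable def pile (G : SimpleGraph V) : List (Letter V) → Piling V
  | [] => fun _ => []
  | s :: w => push G s (pile G w)

lemma pop_push (s : Letter V) (P : Piling V) : pop G s (push G s P) = P := by
  funext x
  unfold pop push
  split_ifs <;> rfl

lemma pop_inv (s : Letter V) : pop G (inv s) = pop G s := rfl

lemma push_comm {s t : Letter V} (h : G.Adj s.1 t.1) (P : Piling V) :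
    push G s (push G t P) = push G t (push G s P) := by
  funext x
  unfold push
  by_cases h1 : x = s.1
  · subst h1
    simp [h, h.ne]
  · by_cases h2 : x = t.1
    · subst h2
      simp [h.symm, h.symm.ne]
    · simp only [h1, h2, if_false]
      split_ifs <;> rfl

lemma pop_comm {s t : Letter V} (P : Piling V) :
    pop G s (pop G t P) = pop G t (pop G s P) := by
  funext x
  unfold pop
  split_ifs <;> rfl

lemma Shuffle.pile_eq {w w' : List (Letter V)} (h : Shuffle G w w') :
    pile G w = pile G w' := by
  induction h with
  | refl w => rfl
  | cons s _ ih => simp only [pile, ih]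
  | swap s t w h => exact push_comm h _
  | trans _ _ ih1 ih2 => exact ih1.trans ih2

lemma stackTop_iff_pile {t : Letter V} {w : List (Letter V)} :
    StackTop G t w ↔ (pile G w t.1).head? = some (some t.2) := by
  induction w with
  | nil => simp [StackTop, pile]
  | cons s w ih =>
    simp only [StackTop, pile, push]
    by_cases h1 : t.1 = s.1
    · simp only [h1, SimpleGraph.irrefl, false_and, or_false, if_true, List.head?_cons,
        Option.some.injEq]
      constructor
      · rintro rfl; rfl
      · intro h; exact Prod.ext h1.symm h
    · have h1' : s ≠ t := fun h => h1 (h ▸ rfl)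
      by_cases h2 : G.Adj t.1 s.1
      · simp [h1, h1', h2, h2.symm, ih]
      · have h2' : ¬ G.Adj s.1 t.1 := fun h => h2 h.symm
        simp [h1, h1', h2, h2']

lemma shuffle_of_pile_eq {w w' : List (Letter V)} (h : pile G w = pile G w') :
    Shuffle G w w' := by
  induction w generalizing w' with
  | nil =>
    cases w' with
    | nil => exact .refl _
    | cons s w' =>
      have := congrFun h s.1
      simp [pile, push] at this
  | cons s w ih =>
    have h1 : StackTop G s w' := by
      rw [stackTop_iff_pile, ← h]; simp [pile, push]
    obtain ⟨w'', h2⟩ := h1.exists_shuffle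
    have h3 : pile G w = pile G w'' := by
      have := congrArg (pop G s) (h.trans h2.pile_eq)
      simpa only [pile, pop_push] using this
    exact (Shuffle.cons s (ih h3)).trans h2.symm

open Classical in
/-- The action of a letter on a piling. -/
noncomputable def act (G : SimpleGraph V) (s : Letter V) (P : Piling V) : Piling V :=
  if (P s.1).head? = some (some (!s.2)) then pop G s P else push G s P

lemma act_pile_of_not {s : Letter V} {w : List (Letter V)} (h : ¬ StackTop G (inv s) w) :
    act G s (pile G w) = pile G (s :: w) := by
  rw [stackTop_iff_pile] at h
  exact if_neg h

lemma act_pile_inv {s : Letter V} {w : List (Letter V)} :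
    act G s (pile G (inv s :: w)) = pile G w := by
  have h : StackTop G (inv s) (inv s :: w) := .inl rfl
  rw [stackTop_iff_pile] at h
  exact (if_pos h).trans (by rw [pile, ← pop_inv, pop_push])

/-- Pilings of reduced words. -/
def ReducedPiling (G : SimpleGraph V) := {P : Piling V // ∃ w, Reduced G w ∧ pile G w = P}

lemma act_valid {s : Letter V} {P : Piling V} (h : ∃ w, Reduced G w ∧ pile G w = P) :
    ∃ w, Reduced G w ∧ pile G w = act G s P := by
  obtain ⟨w, hw, rfl⟩ := h
  by_cases h : StackTop G (inv s) w
  · obtain ⟨w', h'⟩ := h.exists_shuffle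
    refine ⟨w', (h'.reduced hw).1, ?_⟩
    rw [h'.pile_eq, act_pile_inv]
  · exact ⟨s :: w, ⟨hw, h⟩, (act_pile_of_not h).symm⟩

lemma act_inv_act {s : Letter V} {P : Piling V} (h : ∃ w, Reduced G w ∧ pile G w = P) :
    act G (inv s) (act G s P) = P := by
  obtain ⟨w, hw, rfl⟩ := h
  by_cases h : StackTop G (inv s) w
  · obtain ⟨w', h'⟩ := h.exists_shuffle
    rw [h'.pile_eq, act_pile_inv, act_pile_of_not (h'.reduced hw).2]
  · rw [act_pile_of_not h]
    have := act_pile_inv (G := G) (s := inv s) (w := w)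
    rwa [inv_inv] at this

lemma push_apply_of_adj {s : Letter V} {x : V} (h : G.Adj x s.1) (P : Piling V) :
    push G s P x = P x := by
  simp [push, h, h.ne]

lemma pop_apply_of_adj {s : Letter V} {x : V} (h : G.Adj x s.1) (P : Piling V) :
    pop G s P x = P x := by
  simp [pop, h, h.ne]

lemma act_apply_of_adj {s : Letter V} {x : V} (h : G.Adj x s.1) (P : Piling V) :
    act G s P x = P x := by
  unfold act
  split_ifs
  · exact pop_apply_of_adj h P
  · exact push_apply_of_adj h P

lemma push_pop_comm {s t : Letter V} (h : G.Adj s.1 t.1) {w : List (Letter V)}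
    (ht : StackTop G t w) :
    push G s (pop G t (pile G w)) = pop G t (push G s (pile G w)) := by
  obtain ⟨w', h'⟩ := ht.exists_shuffle
  rw [h'.pile_eq, pile, pop_push, push_comm h, pop_push]

lemma act_comm {s t : Letter V} (h : G.Adj s.1 t.1) {P : Piling V}
    (hP : ∃ w, Reduced G w ∧ pile G w = P) :
    act G s (act G t P) = act G t (act G s P) := by
  obtain ⟨w, hw, rfl⟩ := hP
  have e1 := act_apply_of_adj h (pile G w)
  have e2 := act_apply_of_adj h.symm (pile G w)
  rw [act.eq_1 G s (act G t _), act.eq_1 G t (act G s _), e1, e2]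
  unfold act
  by_cases h1 : (pile G w s.1).head? = some (some !s.2) <;>
  by_cases h2 : (pile G w t.1).head? = some (some !t.2) <;>
  simp only [h1, h2, if_true, if_false]
  · exact pop_comm _
  · rw [← pop_inv s]
    exact (push_pop_comm (s := t) (t := inv s) h.symm (stackTop_iff_pile.2 h1)).symm
  · rw [← pop_inv t]
    exact push_pop_comm (s := s) (t := inv t) h (stackTop_iff_pile.2 h2)
  · exact push_comm h _

/-- The permutation of reduced pilings induced by a letter. -/
noncomputable def actPerm (G : SimpleGraph V) (s : Letter V) :
    Equiv.Perm (ReducedPiling G) where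
  toFun P := ⟨act G s P.1, act_valid P.2⟩
  invFun P := ⟨act G (inv s) P.1, act_valid P.2⟩
  left_inv P := Subtype.ext (act_inv_act P.2)
  right_inv P := Subtype.ext (by
    have := act_inv_act (s := inv s) P.2
    rwa [inv_inv] at this)

lemma actPerm_inv (s : Letter V) : actPerm G (inv s) = (actPerm G s)⁻¹ := by
  ext1 P; rfl

end TraceWord

/-- Homomorphisms out of a right-angled Artin group. -/
def RAAG.lift {V : Type*} {G : SimpleGraph V} {H : Type*} [Group H] (f : V → H)
    (hf : ∀ v w, G.Adj v w → f v * f w = f w * f v) : RAAG G →* H :=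
  PresentedGroup.toGroup (f := f) (by
    rintro _ ⟨v, w, h, rfl⟩
    simp [hf v w h])

/-- The standard generators. -/
def RAAG.of {V : Type*} {G : SimpleGraph V} (v : V) : RAAG G := PresentedGroup.of v

@[simp] lemma RAAG.lift_of {V : Type*} {G : SimpleGraph V} {H : Type*} [Group H] (f : V → H)
    (hf : ∀ v w, G.Adj v w → f v * f w = f w * f v) (v : V) :
    RAAG.lift f hf (RAAG.of v : RAAG G) = f v :=
  PresentedGroup.toGroup.of _

lemma RAAG.of_comm {V : Type*} {G : SimpleGraph V} {v w : V} (h : G.Adj v w) :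
    (RAAG.of v * RAAG.of w : RAAG G) = RAAG.of w * RAAG.of v := by
  have h1 : (PresentedGroup.mk (raagRels G)
      (FreeGroup.of v * FreeGroup.of w * (FreeGroup.of v)⁻¹ * (FreeGroup.of w)⁻¹)) = 1 :=
    (PresentedGroup.one_of_mem ⟨v, w, h, rfl⟩)
  rw [map_mul, map_mul, map_mul, map_inv, map_inv] at h1
  exact mul_inv_eq_iff_eq_mul.1 (mul_inv_eq_one.1 h1)

namespace TraceWord

variable {V : Type*} {G : SimpleGraph V}

/-- The group element of a letter. -/
def letterVal (G : SimpleGraph V) (s : Letter V) : RAAG G :=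
  if s.2 then RAAG.of s.1 else (RAAG.of s.1)⁻¹

/-- The group element of a word. -/
def val (G : SimpleGraph V) : List (Letter V) → RAAG G
  | [] => 1
  | s :: w => val G w * letterVal G s

lemma letterVal_inv (s : Letter V) : letterVal G (inv s) = (letterVal G s)⁻¹ := by
  obtain ⟨v, b⟩ := s
  cases b <;> simp [letterVal, inv]

lemma letterVal_comm {s t : Letter V} (h : G.Adj s.1 t.1) :
    letterVal G s * letterVal G t = letterVal G t * letterVal G s := by
  have h1 : Commute (RAAG.of s.1 : RAAG G) (RAAG.of t.1) := RAAG.of_comm h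
  have h2 : Commute (letterVal G s) (letterVal G t) := by
    unfold letterVal
    split_ifs
    · exact h1
    · exact h1.inv_right
    · exact h1.inv_left
    · exact h1.inv_inv
  exact h2

lemma Shuffle.val_eq {w w' : List (Letter V)} (h : Shuffle G w w') : val G w = val G w' := by
  induction h with
  | refl w => rfl
  | cons s _ ih => simp only [val, ih]
  | swap s t w h => simp only [val, mul_assoc, letterVal_comm h]
  | trans _ _ ih1 ih2 => exact ih1.trans ih2

lemma val_append (x y : List (Letter V)) : val G (x ++ y) = val G y * val G x := by
  induction x with
  | nil => simp [val]
  | cons s x ih => simp [val, ih, mul_assoc]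

/-- The formal inverse of a word. -/
def invRev (w : List (Letter V)) : List (Letter V) := (w.map inv).reverse

@[simp] lemma invRev_length (w : List (Letter V)) : (invRev w).length = w.length := by
  simp [invRev]

lemma invRev_cons (s : Letter V) (w : List (Letter V)) : invRev (s :: w) = invRev w ++ [inv s] := by
  simp [invRev]

lemma val_invRev (w : List (Letter V)) : val G (invRev w) = (val G w)⁻¹ := by
  induction w with
  | nil => simp [invRev, val]
  | cons s w ih => simp [invRev_cons, val_append, val, ih, letterVal_inv]

/-- The right action of the group on reduced pilings. -/
noncomputable def pilingAction (G : SimpleGraph V) :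
    RAAG G →* (Equiv.Perm (ReducedPiling G))ᵐᵒᵖ :=
  RAAG.lift (fun v => MulOpposite.op (actPerm G (v, true))) (by
    intro v w h
    rw [← MulOpposite.op_mul, ← MulOpposite.op_mul]
    congr 1
    ext1 P
    exact Subtype.ext (act_comm (s := (w, true)) (t := (v, true)) h.symm P.2))

lemma pilingAction_letterVal (s : Letter V) :
    pilingAction G (letterVal G s) = MulOpposite.op (actPerm G s) := by
  obtain ⟨v, b⟩ := s
  cases b
  · simp only [letterVal, Bool.false_eq_true, if_false, map_inv]
    rw [pilingAction, RAAG.lift_of, ← MulOpposite.op_inv, ← actPerm_inv]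
    rfl
  · simp [letterVal, pilingAction]

/-- The empty piling. -/
noncomputable def emptyPiling (G : SimpleGraph V) : ReducedPiling G :=
  ⟨pile G [], [], trivial, rfl⟩

lemma pilingAction_val {w : List (Letter V)} (h : Reduced G w) :
    ((pilingAction G (val G w)).unop (emptyPiling G)).1 = pile G w := by
  induction w with
  | nil => simp [val, emptyPiling]; rfl
  | cons s w ih =>
    rw [val, map_mul, pilingAction_letterVal, MulOpposite.unop_mul, MulOpposite.unop_op,
      Equiv.Perm.mul_apply]
    change act G s _ = _
    rw [ih h.1, act_pile_of_not h.2]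

/-- Reduced words with the same value differ by a shuffle. -/
lemma Reduced.shuffle_of_val_eq {w w' : List (Letter V)} (h : Reduced G w) (h' : Reduced G w')
    (e : val G w = val G w') : Shuffle G w w' := by
  apply shuffle_of_pile_eq
  rw [← pilingAction_val h, ← pilingAction_val h', e]

/-- Every word can be reduced without increasing the length. -/
lemma exists_reduced_le (w : List (Letter V)) :
    ∃ w', Reduced G w' ∧ val G w' = val G w ∧ w'.length ≤ w.length := by
  induction w with
  | nil => exact ⟨[], trivial, rfl, le_rfl⟩
  | cons s w ih =>
    obtain ⟨w', h1, h2, h3⟩ := ih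
    by_cases h : StackTop G (inv s) w'
    · obtain ⟨w'', h4⟩ := h.exists_shuffle
      refine ⟨w'', (h4.reduced h1).1, ?_, ?_⟩
      · rw [val, ← h2, h4.val_eq, val, letterVal_inv]; simp
      · have := h4.length_eq
        simp only [List.length_cons] at this ⊢
        omega
    · exact ⟨s :: w', ⟨h1, h⟩, by simp [val, h2], by simpa using h3⟩

lemma exists_word (g : RAAG G) : ∃ w, val G w = g := by
  have h : g ∈ Subgroup.closure (Set.range (PresentedGroup.of : V → RAAG G)) := by
    rw [PresentedGroup.closure_range_of]; trivial
  induction h using Subgroup.closure_induction with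
  | mem x hx =>
    obtain ⟨v, rfl⟩ := hx
    exact ⟨[(v, true)], by simp [val, letterVal, RAAG.of]⟩
  | one => exact ⟨[], rfl⟩
  | mul x y _ _ hx hy =>
    obtain ⟨a, rfl⟩ := hx
    obtain ⟨b, rfl⟩ := hy
    exact ⟨b ++ a, val_append _ _⟩
  | inv x _ hx =>
    obtain ⟨a, rfl⟩ := hx
    exact ⟨invRev a, val_invRev a⟩

lemma exists_reduced (g : RAAG G) : ∃ w, Reduced G w ∧ val G w = g := by
  obtain ⟨w, rfl⟩ := exists_word g
  obtain ⟨w', h1, h2, -⟩ := exists_reduced_le (G := G) w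
  exact ⟨w', h1, h2⟩

lemma letterVal_mem (s : Letter V) :
    letterVal G s ∈ raagGen G ∨ (letterVal G s)⁻¹ ∈ raagGen G := by
  obtain ⟨v, b⟩ := s
  cases b
  · exact .inr ⟨v, by simp [letterVal, RAAG.of]⟩
  · exact .inl ⟨v, by simp [letterVal, RAAG.of]⟩

lemma exists_letter {x : RAAG G} (hx : x ∈ raagGen G ∨ x⁻¹ ∈ raagGen G) :
    ∃ s : Letter V, letterVal G s = x := by
  rcases hx with ⟨v, hv⟩ | ⟨v, hv⟩
  · exact ⟨(v, true), by simpa [letterVal, RAAG.of] using hv⟩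
  · refine ⟨(v, false), ?_⟩
    have : (RAAG.of v : RAAG G) = x⁻¹ := hv
    simp [letterVal, this]

lemma wordLength_val_le (w : List (Letter V)) :
    wordLength (raagGen G) (val G w) ≤ w.length := by
  apply Nat.sInf_le
  refine ⟨(w.map (letterVal G)).reverse, by simp, ?_, ?_⟩
  · intro x hx
    simp only [List.mem_reverse, List.mem_map] at hx
    obtain ⟨s, -, rfl⟩ := hx
    exact letterVal_mem s
  · induction w with
    | nil => rfl
    | cons s w ih => simp [val, ih]

lemma exists_word_of_list (L : List (RAAG G)) (hL : ∀ x ∈ L, x ∈ raagGen G ∨ x⁻¹ ∈ raagGen G) :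
    ∃ w : List (Letter V), w.length = L.length ∧ val G w = L.prod := by
  induction L with
  | nil => exact ⟨[], rfl, rfl⟩
  | cons x L ih =>
    obtain ⟨w, h1, h2⟩ := ih fun y hy => hL y (by simp [hy])
    obtain ⟨s, hs⟩ := exists_letter (hL x (by simp))
    exact ⟨w ++ [s], by simp [h1], by simp [val_append, val, h2, hs]⟩

lemma exists_word_length (g : RAAG G) :
    ∃ w : List (Letter V), val G w = g ∧ w.length = wordLength (raagGen G) g := by
  have hne : {k | ∃ w : List (RAAG G), w.length = k ∧
      (∀ x ∈ w, x ∈ raagGen G ∨ x⁻¹ ∈ raagGen G) ∧ w.prod = g}.Nonempty := by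
    obtain ⟨w, rfl⟩ := exists_word g
    refine ⟨_, (w.map (letterVal G)).reverse, rfl, ?_, ?_⟩
    · intro x hx
      simp only [List.mem_reverse, List.mem_map] at hx
      obtain ⟨s, -, rfl⟩ := hx
      exact letterVal_mem s
    · induction w with
      | nil => rfl
      | cons s w ih => simp [val, ih]
  obtain ⟨L, h1, h2, h3⟩ := Nat.sInf_mem hne
  obtain ⟨w, h4, h5⟩ := exists_word_of_list L h2
  exact ⟨w, h5.trans h3, h4.trans h1⟩

lemma Reduced.wordLength_val {w : List (Letter V)} (h : Reduced G w) :
    wordLength (raagGen G) (val G w) = w.length := by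
  obtain ⟨w', h1, h2⟩ := exists_word_length (val G w)
  obtain ⟨w'', h3, h4, h5⟩ := exists_reduced_le (G := G) w'
  have h6 := (h3.shuffle_of_val_eq h (h4.trans h1)).length_eq
  have h7 := wordLength_val_le (G := G) w
  omega

lemma exists_shorter {w : List (Letter V)} (h : ¬ Reduced G w) :
    ∃ w', val G w' = val G w ∧ w'.length < w.length := by
  induction w with
  | nil => exact (h trivial).elim
  | cons s w ih =>
    by_cases hr : Reduced G w
    · have ht : StackTop G (inv s) w := by
        by_contra ht
        exact h ⟨hr, ht⟩
      obtain ⟨w'', h4⟩ := ht.exists_shuffle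
      refine ⟨w'', ?_, ?_⟩
      · rw [val, h4.val_eq, val, letterVal_inv]; simp
      · have := h4.length_eq
        simp only [List.length_cons] at this ⊢
        omega
    · obtain ⟨w', h1, h2⟩ := ih hr
      exact ⟨s :: w', by simp [val, h1], by simpa using h2⟩

lemma reduced_of_wordLength {w : List (Letter V)}
    (h : w.length ≤ wordLength (raagGen G) (val G w)) : Reduced G w := by
  by_contra hr
  obtain ⟨w', h1, h2⟩ := exists_shorter hr
  have := wordLength_val_le (G := G) w'
  rw [h1] at this
  omega

lemma wordLength_mul_le (g h : RAAG G) :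
    wordLength (raagGen G) (g * h) ≤ wordLength (raagGen G) g + wordLength (raagGen G) h := by
  obtain ⟨w, rfl, h1⟩ := exists_word_length g
  obtain ⟨w', rfl, h2⟩ := exists_word_length h
  rw [← val_append, ← h1, ← h2]
  refine (wordLength_val_le _).trans ?_
  simp [add_comm]

lemma wordLength_inv_le (g : RAAG G) :
    wordLength (raagGen G) g⁻¹ ≤ wordLength (raagGen G) g := by
  obtain ⟨w, rfl, h1⟩ := exists_word_length g
  rw [← val_invRev, ← h1]
  exact (wordLength_val_le _).trans (by simp)

lemma wordLength_inv (g : RAAG G) :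
    wordLength (raagGen G) g⁻¹ = wordLength (raagGen G) g :=
  le_antisymm (wordLength_inv_le g) (by simpa using wordLength_inv_le g⁻¹)

@[simp] lemma wordLength_one : wordLength (raagGen G) 1 = 0 :=
  Nat.le_zero.1 (wordLength_val_le (G := G) [])

lemma wordLength_letterVal_le (s : Letter V) : wordLength (raagGen G) (letterVal G s) ≤ 1 := by
  simpa [val] using wordLength_val_le (G := G) [s]

lemma wordLength_of_le (v : V) : wordLength (raagGen G) (RAAG.of v) ≤ 1 := by
  simpa [letterVal] using wordLength_letterVal_le (G := G) (v, true)

lemma Reduced.invRev {w : List (Letter V)} (h : Reduced G w) : Reduced G (invRev w) := by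
  apply reduced_of_wordLength
  rw [val_invRev, wordLength_inv, h.wordLength_val, invRev_length]

/-- The word distance, as a natural number. -/
noncomputable def gdist (G : SimpleGraph V) (g h : RAAG G) : ℕ := wordLength (raagGen G) (g⁻¹ * h)

lemma gdist_self (g : RAAG G) : gdist G g g = 0 := by simp [gdist]

lemma gdist_comm (g h : RAAG G) : gdist G g h = gdist G h g := by
  rw [gdist, ← wordLength_inv, gdist]; simp

lemma gdist_triangle (g h k : RAAG G) : gdist G g k ≤ gdist G g h + gdist G h k := by
  have := wordLength_mul_le (g⁻¹ * h) (h⁻¹ * k)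
  simpa [gdist, mul_assoc] using this

lemma gdist_mul_right_le (g h : RAAG G) : gdist G g (g * h) ≤ wordLength (raagGen G) h := by
  simp [gdist]

lemma gdist_mul_left (k g h : RAAG G) : gdist G (k * g) (k * h) = gdist G g h := by
  simp [gdist, mul_assoc]

/-- A map changing by at most `C` along each edge of the Cayley graph is `C`-Lipschitz. -/
lemma lipschitz_of_step {X : Type*} (d : X → X → ℕ) (d_self : ∀ x, d x x = 0)
    (d_triangle : ∀ x y z, d x z ≤ d x y + d y z) (f : RAAG G → X) (C : ℕ)
    (hf : ∀ g s, d (f g) (f (g * letterVal G s)) ≤ C) (g h : RAAG G) :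
    d (f g) (f h) ≤ C * gdist G g h := by
  obtain ⟨w, h1, h2⟩ := exists_word_length (g⁻¹ * h)
  obtain rfl : h = g * val G w := by rw [h1]; simp
  rw [gdist, ← h2]
  clear h1 h2
  induction w with
  | nil => simp [val, d_self]
  | cons s w ih =>
    have h1 := d_triangle (f g) (f (g * val G w)) (f (g * val G (s :: w)))
    have h2 := hf (g * val G w) s
    rw [mul_assoc, ← val] at h2
    rw [List.length_cons, mul_add, mul_one]
    omega

lemma stackTop_append {t : Letter V} {x y : List (Letter V)} :
    StackTop G t (x ++ y) ↔
      StackTop G t x ∨ ((∀ r ∈ x, G.Adj r.1 t.1) ∧ StackTop G t y) := by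
  induction x with
  | nil => simp [StackTop]
  | cons s x ih =>
    simp only [List.cons_append, StackTop, ih, List.mem_cons, forall_eq_or_imp]
    tauto

/-- The letter `t` can be shuffled to the bottom of the word. -/
def StackBottom (G : SimpleGraph V) (t : Letter V) (B : List (Letter V)) : Prop :=
  ∃ l₁ l₂, B = l₁ ++ t :: l₂ ∧ ∀ r ∈ l₂, G.Adj r.1 t.1

lemma StackBottom.cons {t : Letter V} {B : List (Letter V)} (h : StackBottom G t B)
    (s : Letter V) : StackBottom G t (s :: B) := by
  obtain ⟨l₁, l₂, rfl, h⟩ := h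
  exact ⟨s :: l₁, l₂, rfl, h⟩

lemma reduced_append {B C : List (Letter V)} (hB : Reduced G B) (hC : Reduced G C)
    (h : ∀ t, StackBottom G t B → ¬ StackTop G (inv t) C) : Reduced G (B ++ C) := by
  induction B with
  | nil => exact hC
  | cons s B ih =>
    refine ⟨ih hB.1 fun t ht => h t (ht.cons s), fun ht => ?_⟩
    rcases stackTop_append.1 ht with ht | ⟨h1, h2⟩
    · exact hB.2 ht
    · exact h s ⟨[], B, rfl, h1⟩ h2

lemma StackTop.stackBottom_of_invRev {u : Letter V} {A : List (Letter V)}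
    (h : StackTop G u (TraceWord.invRev A)) : StackBottom G (inv u) A := by
  induction A with
  | nil => exact h.elim
  | cons s A ih =>
    rw [invRev_cons, stackTop_append] at h
    rcases h with h | ⟨h1, h2⟩
    · exact (ih h).cons s
    · rcases h2 with rfl | ⟨-, h2⟩
      · refine ⟨[], A, by simp, fun r hr => ?_⟩
        exact h1 (inv r) (List.mem_reverse.2 (List.mem_map_of_mem hr))
      · exact h2.elim

end TraceWord

namespace CycleRAAG

open TraceWord

variable {n : ℕ}

/-- The two unit directions in `ZMod n`. -/
def dir (n : ℕ) (b : Bool) : ZMod n := if b then 1 else -1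

@[simp] lemma dir_not (b : Bool) : dir n (!b) = -dir n b := by cases b <;> simp [dir]

@[simp] lemma dir_mul_self (b : Bool) : dir n b * dir n b = 1 := by cases b <;> simp [dir]

lemma intCast_ne_zero {c : ℤ} (h0 : c ≠ 0) (h1 : |c| < n) : (c : ZMod n) ≠ 0 := by
  rw [Ne, ZMod.intCast_zmod_eq_zero_iff_dvd]
  intro h
  exact h0 (Int.eq_zero_of_abs_lt_dvd h h1)

/-- Positions `z + a μ` are determined by `a` modulo `n`. -/
lemma add_mul_dir_inj {z : ZMod n} {μ : Bool} {a b : ℤ}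
    (h : z + a * dir n μ = z + b * dir n μ) : (n : ℤ) ∣ a - b := by
  have h1 : ((a - b : ℤ) : ZMod n) = 0 := by
    have h2 := add_left_cancel h
    have h3 := congrArg (· * dir n μ) h2
    simp only [mul_assoc, dir_mul_self, mul_one] at h3
    rw [Int.cast_sub, h3, sub_self]
  exact (ZMod.intCast_zmod_eq_zero_iff_dvd _ _).1 h1

variable [hn : Fact (6 < n)]

lemma cycle_adj_iff {v w : ZMod n} : (cycleGraph n).Adj v w ↔ w = v + 1 ∨ w = v - 1 := by
  have h1 : (1 : ZMod n) ≠ 0 := by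
    have := intCast_ne_zero (n := n) (c := 1) one_ne_zero (by have := hn.out; simp; omega)
    simpa using this
  rw [cycleGraph, SimpleGraph.fromRel_adj]
  constructor
  · rintro ⟨-, h | h⟩
    · exact .inl h
    · exact .inr (by rw [h]; ring)
  · rintro (rfl | rfl)
    · exact ⟨by simpa using h1, .inl rfl⟩
    · exact ⟨by intro h; apply h1; linear_combination h, .inr (by ring)⟩

lemma cycle_adj_iff_dir (b : Bool) {v w : ZMod n} :
    (cycleGraph n).Adj v w ↔ w = v + dir n b ∨ w = v - dir n b := by
  rw [cycle_adj_iff]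
  cases b
  · simp [dir, or_comm, sub_eq_add_neg]
  · simp [dir]

lemma cycle_adj_add (v : ZMod n) (b : Bool) : (cycleGraph n).Adj v (v + dir n b) :=
  (cycle_adj_iff_dir b).2 (.inl rfl)

/-- The right-angled Artin group of the `n`-cycle. -/
abbrev A (n : ℕ) := RAAG (cycleGraph n)

/-- The standard generators. -/
abbrev gen (i : ZMod n) : A n := RAAG.of i

/-- The exponent parity of a generator. -/
noncomputable def parHom (i : ZMod n) : A n →* Multiplicative (ZMod 2) :=
  RAAG.lift (fun j => Multiplicative.ofAdd (if j = i then 1 else 0)) (fun _ _ _ => mul_comm _ _)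

/-- The exponent parity of a generator, as an element of `ZMod 2`. -/
noncomputable def par (i : ZMod n) (k : A n) : ZMod 2 := (parHom i k).toAdd

omit hn in
lemma par_mul (i : ZMod n) (k l : A n) : par i (k * l) = par i k + par i l := by simp [par]

omit hn in
lemma par_gen_zpow (i j : ZMod n) (e : ℤ) :
    par i (gen j ^ e) = if j = i then (e : ZMod 2) else 0 := by
  simp only [par, parHom, map_zpow, RAAG.lift_of]
  split_ifs <;> simp

/-- The closed neighbourhood of a vertex. -/
def nbhd (i : ZMod n) : Set (ZMod n) := {j | j = i ∨ (cycleGraph n).Adj i j}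

/-- The stabiliser of a label of type `i`. -/
def labelGroup (i : ZMod n) : Subgroup (A n) :=
  Subgroup.normalClosure (Set.range fun j => gen j ^ 2) ⊔ Subgroup.closure (gen '' nbhd i)

omit hn in
/-- To bound a label group from above, it suffices to look at its generators under a homomorphism
killing all squares. -/
lemma labelGroup_le {H : Type*} [Group H] (f : A n →* H) (S : Subgroup H)
    (h1 : ∀ j, f (gen j) ^ 2 = 1) {i : ZMod n} (h2 : ∀ j ∈ nbhd i, f (gen j) ∈ S) {l : A n}
    (hl : l ∈ labelGroup i) : f l ∈ S := by
  have : labelGroup i ≤ S.comap f := by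
    refine sup_le ?_ ?_
    · have h3 : Subgroup.normalClosure (Set.range fun j => (gen j : A n) ^ 2) ≤ f.ker := by
        apply Subgroup.normalClosure_le_normal
        rintro _ ⟨j, rfl⟩
        simp [MonoidHom.mem_ker, h1]
      intro l hl
      have := MonoidHom.mem_ker.1 (h3 hl)
      simp [this, S.one_mem]
    · rw [Subgroup.closure_le]
      rintro _ ⟨j, hj, rfl⟩
      exact h2 j hj
  exact this hl

/-- The label of type `i` seen from a chamber. -/
def label (i : ZMod n) (k : A n) : ZMod n × Set (A n) :=
  (i, (fun x => k * x) '' (labelGroup i : Set (A n)))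

omit hn in
lemma label_eq_iff {i j : ZMod n} {k l : A n} :
    label i k = label j l ↔ i = j ∧ k⁻¹ * l ∈ labelGroup i := by
  constructor
  · intro h
    obtain rfl : i = j := congrArg Prod.fst h
    refine ⟨rfl, ?_⟩
    have h2 : (fun x => k * x) '' (labelGroup i : Set (A n)) =
      (fun x => l * x) '' (labelGroup i : Set (A n)) := congrArg Prod.snd h
    have h3 : l ∈ (fun x => k * x) '' (labelGroup i : Set (A n)) := by
      rw [h2]; exact ⟨1, one_mem _, by simp⟩
    obtain ⟨x, hx, rfl⟩ := h3
    simpa using hx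
  · rintro ⟨rfl, h⟩
    refine Prod.ext rfl ?_
    ext x
    constructor
    · rintro ⟨y, hy, rfl⟩
      exact ⟨(k⁻¹ * l)⁻¹ * y, mul_mem (inv_mem h) hy, by simp [mul_assoc]⟩
    · rintro ⟨y, hy, rfl⟩
      exact ⟨(k⁻¹ * l) * y, mul_mem h hy, by simp [mul_assoc]⟩

omit hn in
lemma gen_zpow_mem {i j : ZMod n} (h : j ∈ nbhd i) (e : ℤ) : gen j ^ e ∈ labelGroup i :=
  (labelGroup i).zpow_mem
    (Subgroup.mem_sup_right (Subgroup.subset_closure (Set.mem_image_of_mem _ h))) e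

omit hn in
lemma label_mul_zpow {i j : ZMod n} (h : j ∈ nbhd i) (k : A n) (e : ℤ) :
    label i (k * gen j ^ e) = label i k := by
  rw [eq_comm, label_eq_iff]
  exact ⟨rfl, by simpa using gen_zpow_mem h e⟩

/-- The graph of labels. -/
def labelGraph (n : ℕ) : SimpleGraph (ZMod n × Set (A n)) where
  Adj x y := (cycleGraph n).Adj x.1 y.1 ∧ ∃ k, x = label x.1 k ∧ y = label y.1 k
  symm := ⟨fun _ _ ⟨h, k, h1, h2⟩ => ⟨h.symm, k, h2, h1⟩⟩
  loopless := ⟨fun _ h => h.1.ne rfl⟩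

omit hn in
lemma labelGraph_adj {i j : ZMod n} (h : (cycleGraph n).Adj i j) (k : A n) :
    (labelGraph n).Adj (label i k) (label j k) := ⟨h, k, rfl, rfl⟩

/-- Multiplication by a power of a generator depending only on the parity of its exponent. -/
noncomputable def bump (i : ZMod n) (e : ZMod 2 → ℤ) (k : A n) : A n := k * gen i ^ e (par i k)

omit hn in
lemma par_bump_of_ne {i j : ZMod n} (h : i ≠ j) (e : ZMod 2 → ℤ) (k : A n) :
    par j (bump i e k) = par j k := by
  rw [bump, par_mul, par_gen_zpow, if_neg h, add_zero]

omit hn in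
lemma par_bump_self (i : ZMod n) (e : ZMod 2 → ℤ) (k : A n) :
    par i (bump i e k) = par i k + e (par i k) := by
  rw [bump, par_mul, par_gen_zpow, if_pos rfl]

omit hn in
lemma bump_comm {i j : ZMod n} (h : (cycleGraph n).Adj i j) (e f : ZMod 2 → ℤ) (k : A n) :
    bump i e (bump j f k) = bump j f (bump i e k) := by
  rw [bump, par_bump_of_ne h.ne', bump.eq_1 j f (bump i e k), par_bump_of_ne h.ne, bump, bump,
    mul_assoc, mul_assoc]
  have h1 : Commute (gen i : A n) (gen j) := RAAG.of_comm h
  rw [(h1.zpow_zpow _ _).eq]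

omit hn in
lemma label_bump {i j : ZMod n} (h : j ∈ nbhd i) (e : ZMod 2 → ℤ) (k : A n) :
    label i (bump j e k) = label i k := label_mul_zpow h _ _

/-- Crossing the wall of type `i`. -/
noncomputable def flip (i : ZMod n) (k : A n) : A n := bump i (fun b => if b = 0 then 1 else -1) k

/-- Moving along the line of type `i`. -/
noncomputable def shift (i : ZMod n) (ε : Bool) (k : A n) : A n :=
  bump i (fun b => if b = 0 then (if ε then 2 else -1) else (if ε then 1 else -2)) k

omit hn in
lemma zmod_two_cases (b : ZMod 2) : b = 0 ∨ b = 1 := by revert b; decide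

omit hn in
lemma flip_flip (i : ZMod n) (k : A n) : flip i (flip i k) = k := by
  rw [flip, bump, flip, par_bump_self]
  rcases zmod_two_cases (par i k) with h | h <;> simp [bump, h, show (1 : ZMod 2) + 1 = 0 from rfl]

omit hn in
lemma shift_flip (i : ZMod n) (ε : Bool) (k : A n) : shift i ε (flip i k) = shift i ε k := by
  rw [shift, bump, flip, par_bump_self]
  rcases zmod_two_cases (par i k) with h | h <;> cases ε <;>
    simp [shift, bump, h, show (1 : ZMod 2) + 1 = 0 from rfl, zpow_ofNat, pow_two, mul_assoc]

omit hn in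
lemma wordLength_zpow_le (i : ZMod n) (e : ℤ) :
    wordLength (raagGen (cycleGraph n)) (gen i ^ e) ≤ e.natAbs := by
  have h : ∀ c : ℕ, wordLength (raagGen (cycleGraph n)) (gen i ^ c) ≤ c := by
    intro c
    induction c with
    | zero => simp
    | succ c ih =>
      rw [pow_succ]
      have := wordLength_mul_le (gen i ^ c : A n) (gen i)
      have h1 : wordLength (raagGen (cycleGraph n)) (gen i) ≤ 1 := wordLength_of_le i
      omega
  obtain ⟨c, rfl | rfl⟩ := e.eq_nat_or_neg
  · simpa using h c
  · rw [zpow_neg, wordLength_inv]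
    simpa using h c

omit hn in
lemma gdist_flip (i : ZMod n) (k : A n) : gdist (cycleGraph n) k (flip i k) ≤ 1 := by
  refine (gdist_mul_right_le _ _).trans ((wordLength_zpow_le _ _).trans ?_)
  beta_reduce
  split_ifs <;> simp

omit hn in
lemma gdist_shift (i : ZMod n) (ε : Bool) (k : A n) :
    gdist (cycleGraph n) k (shift i ε k) ≤ 2 := by
  refine (gdist_mul_right_le _ _).trans ((wordLength_zpow_le _ _).trans ?_)
  beta_reduce
  split_ifs <;> simp

/-- The factor picked up by the cocycle when crossing a generator. -/
noncomputable def cocycleFactor (i : ZMod n) (k : A n) : RAAG (labelGraph n) :=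
  if par i k = 0 then 1 else RAAG.of (label i k)

omit hn in
lemma cocycleFactor_mul_zpow {i j : ZMod n} (h : (cycleGraph n).Adj i j) (k : A n) (e : ℤ) :
    cocycleFactor i (k * gen j ^ e) = cocycleFactor i k := by
  rw [cocycleFactor, label_mul_zpow (.inr h), par_mul, par_gen_zpow, if_neg h.ne', add_zero]
  rfl

/-- The permutation of `A_Γ × A_n` induced by a generator. -/
noncomputable def cocyclePerm (i : ZMod n) : Equiv.Perm (RAAG (labelGraph n) × A n) where
  toFun y := (y.1 * cocycleFactor i y.2, y.2 * gen i)
  invFun y := (y.1 * (cocycleFactor i (y.2 * (gen i)⁻¹))⁻¹, y.2 * (gen i)⁻¹)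
  left_inv y := by simp
  right_inv y := by simp

/-- The right action of `A_n` on `A_Γ × A_n` defining the cocycle. -/
noncomputable def cocycleAction (n : ℕ) :
    A n →* (Equiv.Perm (RAAG (labelGraph n) × A n))ᵐᵒᵖ :=
  RAAG.lift (fun i => MulOpposite.op (cocyclePerm i)) (by
    intro i j h
    rw [← MulOpposite.op_mul, ← MulOpposite.op_mul]
    congr 1
    ext1 y
    have h1 := cocycleFactor_mul_zpow h y.2 1
    have h2 := cocycleFactor_mul_zpow h.symm y.2 1
    rw [zpow_one] at h1 h2
    have h3 : Commute (cocycleFactor i y.2) (cocycleFactor j y.2) := by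
      unfold cocycleFactor
      split_ifs
      · exact .one_left _
      · exact .one_left _
      · exact .one_right _
      · exact RAAG.of_comm (labelGraph_adj h _)
    refine Prod.ext ?_ ?_
    · change y.1 * cocycleFactor i y.2 * cocycleFactor j (y.2 * gen i) =
        y.1 * cocycleFactor j y.2 * cocycleFactor i (y.2 * gen j)
      rw [h1, h2, mul_assoc, mul_assoc, h3.eq]
    · change y.2 * gen i * gen j = y.2 * gen j * gen i
      rw [mul_assoc, mul_assoc]
      congr 1
      exact RAAG.of_comm h)

/-- The label map. -/
noncomputable def labelMap (k : A n) : RAAG (labelGraph n) :=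
  ((cocycleAction n k).unop (1, 1)).1

omit hn in
lemma cocycleAction_mul_gen (k : A n) (i : ZMod n) (y) :
    (cocycleAction n (k * gen i)).unop y = cocyclePerm i ((cocycleAction n k).unop y) := by
  rw [map_mul, MulOpposite.unop_mul, Equiv.Perm.mul_apply]
  congr 1

omit hn in
lemma cocycleAction_snd (k : A n) : ((cocycleAction n k).unop (1, 1)).2 = k := by
  obtain ⟨w, rfl⟩ := exists_word k
  induction w with
  | nil => rfl
  | cons s w ih =>
    obtain ⟨i, b⟩ := s
    cases b
    · have h := cocycleAction_mul_gen (val (cycleGraph n) w * (gen i)⁻¹) i (1, 1)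
      rw [inv_mul_cancel_right] at h
      have h2 : ((cocycleAction n (val (cycleGraph n) w)).unop (1, 1)).2 =
        ((cocycleAction n (val (cycleGraph n) w * (gen i)⁻¹)).unop (1, 1)).2 * gen i := by
        rw [h]; rfl
      rw [ih] at h2
      exact (eq_mul_inv_of_mul_eq h2.symm)
    · change ((cocycleAction n (val (cycleGraph n) w * gen i)).unop (1, 1)).2 = _
      rw [cocycleAction_mul_gen]
      change ((cocycleAction n (val (cycleGraph n) w)).unop (1, 1)).2 * gen i = _
      rw [ih]; rfl

omit hn in
lemma labelMap_mul_gen (k : A n) (i : ZMod n) :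
    labelMap (k * gen i) = labelMap k * cocycleFactor i k := by
  rw [labelMap, cocycleAction_mul_gen]
  change _ * cocycleFactor i ((cocycleAction n k).unop (1, 1)).2 = _
  rw [cocycleAction_snd]; rfl

omit hn in
lemma labelMap_mul_gen_inv (k : A n) (i : ZMod n) :
    labelMap (k * (gen i)⁻¹) =
      labelMap k * (if par i k = 0 then (RAAG.of (label i k))⁻¹ else 1) := by
  have h := labelMap_mul_gen (k * (gen i)⁻¹) i
  rw [inv_mul_cancel_right] at h
  rw [eq_mul_inv_of_mul_eq h.symm]
  congr 1
  rw [← zpow_neg_one (gen i), cocycleFactor, label_mul_zpow (.inl rfl), par_mul, par_gen_zpow]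
  rcases zmod_two_cases (par i k) with h | h <;> simp [h, show (1 : ZMod 2) + 1 = 0 from rfl]

omit hn in
lemma gdist_labelMap_step (k : A n) (s : Letter (ZMod n)) :
    gdist (labelGraph n) (labelMap k) (labelMap (k * letterVal (cycleGraph n) s)) ≤ 1 := by
  obtain ⟨i, b⟩ := s
  cases b
  · change gdist (labelGraph n) (labelMap k) (labelMap (k * (gen i)⁻¹)) ≤ 1
    rw [labelMap_mul_gen_inv]
    refine (gdist_mul_right_le _ _).trans ?_
    split_ifs
    · rw [wordLength_inv]; exact wordLength_of_le _
    · simp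
  · change gdist (labelGraph n) (labelMap k) (labelMap (k * gen i)) ≤ 1
    rw [labelMap_mul_gen, cocycleFactor]
    refine (gdist_mul_right_le _ _).trans ?_
    split_ifs
    · simp
    · exact wordLength_of_le _

omit hn in
lemma gdist_labelMap_le (k l : A n) :
    gdist (labelGraph n) (labelMap k) (labelMap l) ≤ gdist (cycleGraph n) k l := by
  simpa using lipschitz_of_step (gdist (labelGraph n)) gdist_self gdist_triangle
    labelMap 1 gdist_labelMap_step k l

omit hn in
lemma labelMap_flip (i : ZMod n) (k : A n) : labelMap (flip i k) = labelMap k := by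
  rw [flip, bump]
  rcases zmod_two_cases (par i k) with h | h
  · simp [h, labelMap_mul_gen, cocycleFactor]
  · simp [h, labelMap_mul_gen_inv]

omit hn in
lemma labelMap_shift (i : ZMod n) (ε : Bool) (k : A n) :
    labelMap (shift i ε k) = labelMap k * letterVal (labelGraph n) (label i k, ε) := by
  have e1 : par i (gen i) = 1 := by simpa using par_gen_zpow i i 1
  have e2 : par i (gen i)⁻¹ = 1 := by simpa using par_gen_zpow i i (-1)
  have e3 : label i (k * gen i) = label i k := by simpa using label_mul_zpow (.inl rfl) k 1
  have e4 : label i (k * (gen i)⁻¹) = label i k := by simpa using label_mul_zpow (.inl rfl) k (-1)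
  rw [shift, bump]
  rcases zmod_two_cases (par i k) with h | h <;> cases ε
  · simp [h, labelMap_mul_gen_inv, letterVal]
  · rw [show (if par i k = 0 then (if true = true then (2 : ℤ) else -1) else
      (if true = true then 1 else -2)) = 2 by simp [h]]
    rw [zpow_ofNat, pow_two, ← mul_assoc, labelMap_mul_gen, labelMap_mul_gen, cocycleFactor,
      cocycleFactor, par_mul, e1, h, e3]
    simp [letterVal]
  · rw [show (if par i k = 0 then (if false = true then (2 : ℤ) else -1) else
      (if false = true then 1 else -2)) = -2 by simp [h]]
    rw [zpow_neg, zpow_ofNat, pow_two, mul_inv_rev, ← mul_assoc, labelMap_mul_gen_inv,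
      labelMap_mul_gen_inv, par_mul, e2, h, e4]
    simp [letterVal, show (1 : ZMod 2) + 1 = 0 from rfl]
  · simp [h, labelMap_mul_gen, letterVal, cocycleFactor]

end CycleRAAG

namespace CycleRAAG

open TraceWord

variable {n : ℕ}

/-- The vertex `a` steps away from `z` in direction `μ`. -/
def pos (z : ZMod n) (μ : Bool) (a : ℤ) : ZMod n := z + a * dir n μ

@[simp] lemma pos_zero (z : ZMod n) (μ : Bool) : pos z μ 0 = z := by simp [pos]

@[simp] lemma pos_pos (z : ZMod n) (μ : Bool) (a b : ℤ) : pos (pos z μ a) μ b = pos z μ (a + b) := by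
  simp [pos]; ring

@[simp] lemma pos_not (z : ZMod n) (μ : Bool) (a : ℤ) : pos z (!μ) a = pos z μ (-a) := by
  simp [pos]

lemma pos_add_dir (z : ZMod n) (μ : Bool) (a : ℤ) : pos z μ a + dir n μ = pos z μ (a + 1) := by
  simp [pos]; ring

lemma pos_sub_dir (z : ZMod n) (μ : Bool) (a : ℤ) : pos z μ a - dir n μ = pos z μ (a - 1) := by
  simp [pos]; ring

lemma pos_add_n (z : ZMod n) (μ : Bool) (a : ℤ) : pos z μ (a + n) = pos z μ a := by simp [pos]

lemma pos_ne {z : ZMod n} {μ : Bool} {a b : ℤ} (h0 : a - b ≠ 0) (h1 : -n < a - b) (h2 : a - b < n) :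
    pos z μ a ≠ pos z μ b := fun h =>
  h0 (Int.eq_zero_of_abs_lt_dvd (add_mul_dir_inj h) (abs_lt.2 ⟨h1, h2⟩))

variable [hn : Fact (6 < n)]

lemma mem_nbhd_pos {z : ZMod n} {μ : Bool} {a : ℤ} {j : ZMod n} :
    j ∈ nbhd (pos z μ a) ↔ j = pos z μ a ∨ j = pos z μ (a + 1) ∨ j = pos z μ (a - 1) := by
  rw [nbhd, Set.mem_ofPred_eq, cycle_adj_iff_dir μ, pos_add_dir, pos_sub_dir]

lemma pos_not_mem_nbhd {z : ZMod n} {μ : Bool} {a b : ℤ} (h1 : 2 ≤ |a - b|)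
    (h2 : |a - b| ≤ n - 2) : pos z μ a ∉ nbhd (pos z μ b) := by
  have hn := hn.out
  rw [mem_nbhd_pos]
  rw [le_abs] at h1
  rw [abs_le] at h2
  rintro (h | h | h) <;> refine pos_ne ?_ ?_ ?_ h <;> omega

lemma pos_not_adj {z : ZMod n} {μ : Bool} {a b : ℤ} (h1 : 2 ≤ |a - b|)
    (h2 : |a - b| ≤ n - 2) : ¬ (cycleGraph n).Adj (pos z μ a) (pos z μ b) := fun h =>
  pos_not_mem_nbhd h1 h2 (.inr h.symm)

/-- The involution exchanging `2 k` and `2 k + 1`. -/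
def swapUp : Equiv.Perm ℤ :=
  Function.Involutive.toPerm (fun h => if h % 2 = 0 then h + 1 else h - 1) (by
    intro h; dsimp only; split_ifs <;> omega)

/-- The involution exchanging `2 k - 1` and `2 k`. -/
def swapDown : Equiv.Perm ℤ :=
  Function.Involutive.toPerm (fun h => if h % 2 = 0 then h - 1 else h + 1) (by
    intro h; dsimp only; split_ifs <;> omega)

omit hn in
lemma swapUp_apply (h : ℤ) : swapUp h = if h % 2 = 0 then h + 1 else h - 1 := rfl

omit hn in
lemma swapDown_apply (h : ℤ) : swapDown h = if h % 2 = 0 then h - 1 else h + 1 := rfl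

/-- The image of a generator under the height homomorphism. -/
def heightPerm (x : ZMod n) (μ : Bool) (j : ZMod n) : Equiv.Perm ℤ :=
  if j = x then swapUp else if j = pos x μ 4 then swapDown else 1

omit hn in
lemma heightPerm_sq (x : ZMod n) (μ : Bool) (j : ZMod n) :
    heightPerm x μ j * heightPerm x μ j = 1 := by
  ext h
  rw [Equiv.Perm.mul_apply]
  unfold heightPerm
  split_ifs
  · simp only [swapUp_apply, Equiv.Perm.coe_one, id]; split_ifs <;> omega
  · simp only [swapDown_apply, Equiv.Perm.coe_one, id]; split_ifs <;> omega
  · rfl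

/-- The action of `A_n` on a line through the reflections at `x` and `x + 4 μ`. -/
def heightHom (x : ZMod n) (μ : Bool) : A n →* (Equiv.Perm ℤ)ᵐᵒᵖ :=
  RAAG.lift (fun j => MulOpposite.op (heightPerm x μ j)) (by
    intro i j h
    rw [← MulOpposite.op_mul, ← MulOpposite.op_mul]
    congr 1
    have h0 : ¬ (cycleGraph n).Adj x (pos x μ 4) := by
      have := hn.out
      have h := pos_not_adj (n := n) (z := x) (μ := μ) (a := 0) (b := 4) (by norm_num) (by
        norm_num; omega)
      rwa [pos_zero] at h
    unfold heightPerm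
    by_cases h1 : j = x <;> by_cases h2 : i = x <;> simp only [h1, h2, if_true, if_false]
    · by_cases h3 : i = pos x μ 4
      · subst h1 h3; exact (h0 h.symm).elim
      · simp [h3]
    · by_cases h3 : j = pos x μ 4
      · subst h2 h3; exact (h0 h).elim
      · simp [h3]
    · split_ifs <;> simp)

/-- The height of a chamber relative to a base chamber. -/
def height (x : ZMod n) (μ : Bool) (K k : A n) : ℤ := (heightHom x μ (K⁻¹ * k)).unop 0

lemma height_self (x : ZMod n) (μ : Bool) (K : A n) : height x μ K K = 0 := by simp [height]

lemma height_mul (x : ZMod n) (μ : Bool) (K k l : A n) :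
    height x μ K (k * l) = (heightHom x μ l).unop (height x μ K k) := by
  rw [height, ← mul_assoc, map_mul]; rfl

lemma heightHom_gen (x : ZMod n) (μ : Bool) (j : ZMod n) :
    heightHom x μ (gen j) = MulOpposite.op (heightPerm x μ j) := RAAG.lift_of _ _ _

lemma height_flip (x : ZMod n) (μ : Bool) (K k : A n) (j : ZMod n) :
    height x μ K (flip j k) = heightPerm x μ j (height x μ K k) := by
  rw [flip, bump, height_mul]
  split_ifs
  · rw [zpow_one, heightHom_gen]; rfl
  · rw [zpow_neg_one, map_inv, heightHom_gen, ← MulOpposite.op_inv,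
      inv_eq_of_mul_eq_one_left (heightPerm_sq x μ j)]; rfl

/-- Functions on the line invariant under the reflections of the generators in a closed
neighbourhood are determined by the label. -/
lemma height_invariant {x : ZMod n} {μ : Bool} {i : ZMod n} (g : ℤ → ℤ)
    (hg : ∀ j ∈ nbhd i, ∀ h, g (heightPerm x μ j h) = g h) {K k l : A n}
    (hl : label i k = label i l) : g (height x μ K l) = g (height x μ K k) := by
  let S : Subgroup (Equiv.Perm ℤ)ᵐᵒᵖ :=
    { carrier := {π | ∀ h, g (π.unop h) = g h}
      one_mem' := fun h => rfl
      mul_mem' := fun {a b} ha hb h => by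
        change g (b.unop (a.unop h)) = g h
        rw [hb, ha]
      inv_mem' := fun {a} ha h => by
        have := ha (a.unop⁻¹ h)
        rw [← Equiv.Perm.mul_apply, mul_inv_cancel] at this
        exact this.symm }
  have h1 : heightHom x μ (k⁻¹ * l) ∈ S := by
    refine labelGroup_le _ S (fun j => ?_) (fun j hj => ?_) (label_eq_iff.1 hl).2
    · rw [heightHom_gen, pow_two, ← MulOpposite.op_mul, heightPerm_sq]; rfl
    · rw [heightHom_gen]; exact hg j hj
  have h2 := height_mul x μ K k (k⁻¹ * l)
  rw [mul_inv_cancel_left] at h2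
  rw [h2]
  exact h1 _

lemma height_eq_of_label_eq {x : ZMod n} {μ : Bool} {i : ZMod n} (hx : x ∉ nbhd i)
    (hy : pos x μ 4 ∉ nbhd i) {K k l : A n} (hl : label i k = label i l) :
    height x μ K l = height x μ K k := by
  refine height_invariant id (fun j hj h => ?_) hl
  have h1 : j ≠ x := fun e => hx (e ▸ hj)
  have h2 : j ≠ pos x μ 4 := fun e => hy (e ▸ hj)
  simp [heightPerm, h1, h2]

lemma height_div_eq_of_label_eq {x : ZMod n} {μ : Bool} {i : ZMod n}
    (hy : pos x μ 4 ∉ nbhd i) {K k l : A n} (hl : label i k = label i l) :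
    height x μ K l / 2 = height x μ K k / 2 := by
  refine height_invariant (· / 2) (fun j hj h => ?_) hl
  have h2 : j ≠ pos x μ 4 := fun e => hy (e ▸ hj)
  rw [heightPerm]
  split_ifs
  · simp only [swapUp_apply]; split_ifs <;> omega
  · rfl

lemma height_add_div_eq_of_label_eq {x : ZMod n} {μ : Bool} {i : ZMod n}
    (hx : x ∉ nbhd i) {K k l : A n} (hl : label i k = label i l) :
    (height x μ K l + 1) / 2 = (height x μ K k + 1) / 2 := by
  refine height_invariant (fun h => (h + 1) / 2) (fun j hj h => ?_) hl
  have h2 : j ≠ x := fun e => hx (e ▸ hj)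
  rw [heightPerm, if_neg h2]
  split_ifs
  · simp only [swapDown_apply]; split_ifs <;> omega
  · rfl

lemma not_mem_nbhd_or (x : ZMod n) (μ : Bool) (i : ZMod n) :
    x ∉ nbhd i ∨ pos x μ 4 ∉ nbhd i := by
  have hn := hn.out
  by_contra! h
  obtain ⟨h1, h2⟩ := h
  rw [← pos_zero i μ] at h1 h2
  rw [mem_nbhd_pos] at h1 h2
  obtain rfl | rfl | rfl := h1 <;> rw [pos_pos] at h2 <;>
    rcases h2 with h2 | h2 | h2 <;> refine pos_ne ?_ ?_ ?_ h2 <;> omega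

/-- Chambers with equal labels have close heights. -/
lemma height_lt_add_two_of_label_eq {x : ZMod n} {μ : Bool} {i : ZMod n} {K k l : A n}
    (hl : label i k = label i l) : height x μ K l < height x μ K k + 2 := by
  rcases not_mem_nbhd_or x μ i with h | h
  · have := height_add_div_eq_of_label_eq (K := K) (μ := μ) h hl
    omega
  · have := height_div_eq_of_label_eq (K := K) (μ := μ) h hl
    omega

omit hn in
lemma par_eq_of_label_eq {c i : ZMod n} (hc : c ∉ nbhd i) {k l : A n}
    (hl : label i k = label i l) : par c k = par c l := by
  have h1 : parHom c (k⁻¹ * l) ∈ (⊥ : Subgroup (Multiplicative (ZMod 2))) := by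
    refine labelGroup_le _ ⊥ (fun j => ?_) (fun j hj => ?_) (label_eq_iff.1 hl).2
    · have h : par c (gen j ^ (2 : ℤ)) = 0 := by
        rw [par_gen_zpow]; split_ifs <;> rfl
      rw [par, zpow_ofNat, map_pow] at h
      exact h
    · have h : par c (gen j ^ (1 : ℤ)) = 0 := by
        rw [par_gen_zpow, if_neg]
        rintro rfl; exact hc hj
      rw [par, zpow_one] at h
      exact h
  have h2 : par c (k⁻¹ * l) = 0 := congrArg Multiplicative.toAdd (Subgroup.mem_bot.1 h1)
  have h3 := par_mul c k (k⁻¹ * l)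
  rw [mul_inv_cancel_left, h2, add_zero] at h3
  exact h3.symm

/-- The vertex `z` and direction `μ` that occur at height `r` in the standard cycle. -/
def Level (x : ZMod n) (μ₀ : Bool) (z : ZMod n) (μ : Bool) (r : ℤ) : Prop :=
  (z = x ∧ μ = μ₀ ∧ r % 2 = 1) ∨ (z = pos x μ₀ 4 ∧ μ = !μ₀ ∧ r % 2 = 0)

omit hn in
lemma Level.next {x : ZMod n} {μ₀ : Bool} {z : ZMod n} {μ : Bool} {r : ℤ}
    (h : Level x μ₀ z μ r) : Level x μ₀ (pos z μ 4) (!μ) (r + 1) := by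
  rcases h with ⟨rfl, rfl, h⟩ | ⟨rfl, rfl, h⟩
  · exact .inr ⟨rfl, rfl, by omega⟩
  · exact .inl ⟨by simp, by simp, by omega⟩

lemma Level.height_flip_four {x : ZMod n} {μ₀ : Bool} {z : ZMod n} {μ : Bool} {K k : A n}
    (h : Level x μ₀ z μ (height x μ₀ K k)) :
    height x μ₀ K (flip (pos z μ 4) k) = height x μ₀ K k + 1 := by
  rw [height_flip, heightPerm]
  have hn := hn.out
  have h1 : pos x μ₀ 4 ≠ x := by
    have := pos_ne (n := n) (z := x) (μ := μ₀) (a := 4) (b := 0) (by omega) (by omega) (by omega)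
    rwa [pos_zero] at this
  rcases h with ⟨rfl, rfl, h⟩ | ⟨rfl, rfl, h⟩
  · rw [if_neg h1, if_pos rfl, swapDown_apply, if_neg (by omega)]
  · rw [if_pos (by simp), swapUp_apply, if_pos (by omega)]

lemma Level.height_flip_three {x : ZMod n} {μ₀ : Bool} {z : ZMod n} {μ : Bool} {K k : A n} {r : ℤ}
    (h : Level x μ₀ z μ r) :
    height x μ₀ K (flip (pos z μ 3) k) = height x μ₀ K k := by
  rw [height_flip, heightPerm]
  have hn := hn.out
  rcases h with ⟨rfl, rfl, h⟩ | ⟨rfl, rfl, h⟩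
  · rw [if_neg, if_neg]
    · rfl
    · exact pos_ne (by omega) (by omega) (by omega)
    · have := pos_ne (n := n) (z := z) (μ := μ) (a := 3) (b := 0) (by omega) (by omega) (by omega)
      rwa [pos_zero] at this
  · rw [if_neg, if_neg]
    · rfl
    · rw [pos_not, pos_pos]
      exact pos_ne (by omega) (by omega) (by omega)
    · rw [pos_not, pos_pos]
      have := pos_ne (n := n) (z := x) (μ := μ₀) (a := 1) (b := 0) (by omega) (by omega) (by omega)
      rwa [pos_zero] at this

/-- A chamber can be told from lower ones by the labels of types not adjacent to `z`. -/
lemma Level.label_ne {x : ZMod n} {μ₀ : Bool} {z : ZMod n} {μ : Bool} {K k l : A n}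
    (h : Level x μ₀ z μ (height x μ₀ K k)) (hl : height x μ₀ K l < height x μ₀ K k)
    {i : ZMod n} (hi : z ∉ nbhd i) : label i k ≠ label i l := by
  intro e
  rcases h with ⟨rfl, rfl, h⟩ | ⟨rfl, rfl, h⟩
  · have := height_add_div_eq_of_label_eq (K := K) (μ := μ) hi e
    omega
  · have := height_div_eq_of_label_eq (K := K) (x := x) (μ := μ₀) hi e
    omega

end CycleRAAG

namespace CycleRAAG

open TraceWord

variable {n : ℕ}

/-- A vertex of a standard cycle: its type, the direction of arrival and the chamber containing
the edge of arrival. -/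
structure Ent (n : ℕ) where
  /-- the type -/
  typ : ZMod n
  /-- the direction of arrival -/
  d : Bool
  /-- the chamber of arrival -/
  ch : A n

/-- The label of a vertex. -/
def Ent.lab (e : Ent n) : ZMod n × Set (A n) := label e.typ e.ch

/-- The chamber `E'` is `E` or its neighbour across the wall of type `i`. -/
def Near (i : ZMod n) (E E' : A n) : Prop := E' = E ∨ E' = flip i E

/-- Consecutive vertices, going straight on. -/
def Straight (e e' : Ent n) : Prop :=
  e'.typ = pos e.typ e.d 1 ∧ e'.d = e.d ∧ Near e.typ e.ch e'.ch

/-- Consecutive vertices, folding back. -/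
def Fold (e e' : Ent n) : Prop :=
  e'.typ = pos e.typ e.d (-1) ∧ e'.d = (!e.d) ∧ Near e.typ (flip (pos e.typ e.d 1) e.ch) e'.ch

/-- Consecutive vertices. -/
def Step (e e' : Ent n) : Prop := Straight e e' ∨ Fold e e'

/-- A straight segment inside a chamber. -/
def seg (z : ZMod n) (μ : Bool) (k : A n) (a len : ℕ) : List (Ent n) :=
  (List.range' a len).map fun i : ℕ => ⟨pos z μ i, μ, k⟩

/-- The last position inside a chamber of given kind; `true` stands for a star junction and
`false` for an edge junction. -/
def top (n : ℕ) (κ : Bool) : ℕ := if κ then n - 2 else n - 1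

/-- The vertex reached after an arc. -/
def arcExit (κ : Bool) (k : A n) (z : ZMod n) (μ : Bool) : Ent n := ⟨pos z μ (top n κ + 1 : ℕ), μ, k⟩

/-- The chamber behind a junction. -/
noncomputable def nextCh (κ : Bool) (k : A n) (z : ZMod n) (μ : Bool) : A n :=
  if κ then flip (pos z μ 4) k else flip (pos z μ 3) (flip (pos z μ 4) k)

/-- The position where a chamber is entered again after a junction. -/
def resume (κ : Bool) : ℕ := if κ then 6 else 5

/-- Nested arcs. -/
noncomputable def arc : Bool → List Bool → A n → ZMod n → Bool → List (Ent n)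
  | κ, [], k, z, μ => seg z μ k 2 (top n κ - 1)
  | κ, κ' :: ks, k, z, μ =>
    ⟨pos z μ 2, μ, k⟩ :: ⟨pos z μ 3, μ, k⟩ ::
      (arc κ' ks (nextCh κ' k z μ) (pos z μ 4) (!μ) ++
        arcExit κ' (nextCh κ' k z μ) (pos z μ 4) (!μ) ::
          seg z μ k (resume κ') (top n κ + 1 - resume κ'))

/-- The standard cycle. -/
noncomputable def cyc (ks : List Bool) (K : A n) (z : ZMod n) (μ : Bool) : List (Ent n) :=
  ⟨pos z μ 1, !μ, K⟩ :: (arc true ks (flip z K) z μ ++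
    arcExit true (flip z K) z μ :: seg z (!μ) K 2 (n - 3))

@[simp] lemma seg_length (z : ZMod n) (μ : Bool) (k : A n) (a len : ℕ) :
    (seg z μ k a len).length = len := by simp [seg]

lemma seg_succ (z : ZMod n) (μ : Bool) (k : A n) (a len : ℕ) :
    seg z μ k a (len + 1) = ⟨pos z μ a, μ, k⟩ :: seg z μ k (a + 1) len := by
  simp [seg, List.range'_succ]

lemma seg_concat (z : ZMod n) (μ : Bool) (k : A n) (a len : ℕ) :
    seg z μ k a len ++ [⟨pos z μ (a + len : ℕ), μ, k⟩] = seg z μ k a (len + 1) := by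
  simp [seg, List.range'_concat]

lemma mem_seg {z : ZMod n} {μ : Bool} {k : A n} {a len : ℕ} {e : Ent n} :
    e ∈ seg z μ k a len ↔ ∃ i : ℕ, a ≤ i ∧ i < a + len ∧ e = ⟨pos z μ i, μ, k⟩ := by
  simp only [seg, List.mem_map, List.mem_range'_1, eq_comm, and_assoc]

lemma isChain_seg (z : ZMod n) (μ : Bool) (k : A n) (a len : ℕ) :
    (seg z μ k a len).IsChain Step := by
  induction len generalizing a with
  | zero => exact List.IsChain.nil
  | succ len ih =>
    rw [seg_succ]
    cases len with
    | zero => exact List.isChain_singleton _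
    | succ len =>
      have h := ih (a + 1)
      rw [seg_succ] at h ⊢
      refine List.isChain_cons_cons.2 ⟨.inl ⟨?_, rfl, .inl rfl⟩, h⟩
      simp

variable [hn : Fact (6 < n)]

lemma arcExit_true (k : A n) (z : ZMod n) (μ : Bool) :
    arcExit true k z μ = ⟨pos z μ (-1), μ, k⟩ := by
  have hn := hn.out
  rw [arcExit, ← pos_add_n z μ (-1), Ent.mk.injEq]
  exact ⟨by congr 1; simp [top]; omega, rfl, rfl⟩

lemma arcExit_false (k : A n) (z : ZMod n) (μ : Bool) :
    arcExit false k z μ = ⟨z, μ, k⟩ := by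
  have hn := hn.out
  rw [arcExit, Ent.mk.injEq]
  refine ⟨?_, rfl, rfl⟩
  rw [show ((top n false + 1 : ℕ) : ℤ) = 0 + n by simp [top]; omega, pos_add_n, pos_zero]

/-- The number of vertices contributed by a junction. -/
def junctionLength (n : ℕ) (κ : Bool) : ℕ := if κ then n - 4 else n - 2

lemma arc_length (κ : Bool) (ks : List Bool) (k : A n) (z : ZMod n) (μ : Bool) :
    (arc κ ks k z μ).length = top n κ - 1 + (ks.map (junctionLength n)).sum := by
  have hn := hn.out
  induction ks generalizing κ k z μ with
  | nil => simp [arc]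
  | cons κ' ks ih =>
    simp only [arc, List.length_cons, List.length_append, ih, seg_length, List.map_cons,
      List.sum_cons]
    unfold top junctionLength resume
    cases κ <;> cases κ' <;> simp <;> omega

lemma cyc_length (ks : List Bool) (K : A n) (z : ZMod n) (μ : Bool) :
    (cyc ks K z μ).length = 2 * n - 4 + (ks.map (junctionLength n)).sum := by
  have hn := hn.out
  simp only [cyc, List.length_cons, List.length_append, arc_length, seg_length, top]
  simp
  omega

lemma isChain_arc (κ : Bool) (ks : List Bool) (k k₀ : A n) (z : ZMod n) (μ : Bool)
    (hk : Near (pos z μ 1) (flip z k₀) k) :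
    (⟨pos z μ 1, !μ, k₀⟩ :: (arc κ ks k z μ ++ [arcExit κ k z μ])).IsChain Step := by
  have hn := hn.out
  induction ks generalizing κ k k₀ z μ with
  | nil =>
    obtain ⟨c, hc⟩ : ∃ c, top n κ - 1 = c + 1 := ⟨top n κ - 2, by unfold top; split_ifs <;> omega⟩
    have h1 : top n κ + 1 = 2 + (c + 1) := by omega
    rw [arc, arcExit, hc, h1, seg_concat, seg_succ]
    refine List.isChain_cons_cons.2 ⟨.inr ⟨?_, ?_, ?_⟩, ?_⟩
    · simp
    · simp
    · simpa using hk
    · rw [← seg_succ]; exact isChain_seg _ _ _ _ _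
  | cons κ' ks ih =>
    have h2 : Near (pos (pos z μ 4) (!μ) 1) (flip (pos z μ 4) k) (nextCh κ' k z μ) := by
      have e : pos (pos z μ 4) (!μ) 1 = pos z μ 3 := by rw [pos_not, pos_pos]; norm_num
      rw [e]
      cases κ'
      · exact .inr rfl
      · exact .inl rfl
    have h1 := ih κ' (nextCh κ' k z μ) k (pos z μ 4) (!μ) h2
    rw [pos_not, pos_pos, Bool.not_not, show (4 : ℤ) + -1 = 3 by norm_num] at h1
    obtain ⟨c, hc⟩ : ∃ c, top n κ + 1 - resume κ' = c ∧ top n κ + 1 = resume κ' + c :=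
      ⟨_, rfl, by unfold top resume; split_ifs <;> omega⟩
    have h3 : (seg z μ k (resume κ') (c + 1)).IsChain Step := isChain_seg _ _ _ _ _
    rw [arc, hc.1]
    have e1 : (⟨pos z μ 1, !μ, k₀⟩ :: ((⟨pos z μ 2, μ, k⟩ :: ⟨pos z μ 3, μ, k⟩ ::
      (arc κ' ks (nextCh κ' k z μ) (pos z μ 4) (!μ) ++
        arcExit κ' (nextCh κ' k z μ) (pos z μ 4) (!μ) :: seg z μ k (resume κ') c)) ++
          [arcExit κ k z μ]) : List (Ent n)) =
      [⟨pos z μ 1, !μ, k₀⟩, ⟨pos z μ 2, μ, k⟩] ++ ((⟨pos z μ 3, μ, k⟩ ::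
        (arc κ' ks (nextCh κ' k z μ) (pos z μ 4) (!μ) ++
        [arcExit κ' (nextCh κ' k z μ) (pos z μ 4) (!μ)])) ++ seg z μ k (resume κ') (c + 1)) := by
      rw [← seg_concat, ← hc.2, arcExit, arcExit]; simp
    rw [e1, List.isChain_append]
    refine ⟨?_, ?_, ?_⟩
    · refine List.isChain_cons_cons.2 ⟨.inr ⟨?_, ?_, ?_⟩, List.isChain_singleton _⟩
      · simp
      · simp
      · simpa using hk
    · rw [List.isChain_append]
      refine ⟨h1, h3, ?_⟩
      rw [← List.cons_append, List.getLast?_concat, seg_succ]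
      simp only [Option.mem_def, Option.some.injEq, List.head?_cons, forall_eq']
      cases κ'
      · rw [arcExit_false]
        exact .inr ⟨by simp [resume], by simp, .inr (by simp [nextCh, flip_flip])⟩
      · rw [arcExit_true]
        exact .inr ⟨by simp [resume], by simp, .inl (by simp [nextCh, flip_flip])⟩
    · simp only [List.getLast?_cons_cons, List.getLast?_singleton, Option.mem_def,
        Option.some.injEq, List.cons_append, List.head?_cons, forall_eq']
      exact .inl ⟨by simp, rfl, .inl rfl⟩

lemma isChain_cyc (ks : List Bool) (K : A n) (z : ZMod n) (μ : Bool) :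
    (cyc ks K z μ ++ [(⟨pos z μ 1, !μ, K⟩ : Ent n)]).IsChain Step := by
  have hn := hn.out
  have e0 : (⟨pos z μ 1, !μ, K⟩ : Ent n) = ⟨pos z (!μ) (2 + (n - 3) : ℕ), !μ, K⟩ := by
    rw [pos_not, ← pos_add_n z μ (-_), Ent.mk.injEq]
    exact ⟨by congr 1; omega, rfl, rfl⟩
  have e1 : (cyc ks K z μ ++ [⟨pos z μ 1, !μ, K⟩] : List (Ent n)) =
      (⟨pos z μ 1, !μ, K⟩ :: (arc true ks (flip z K) z μ ++ [arcExit true (flip z K) z μ])) ++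
        seg z (!μ) K 2 (n - 3 + 1) := by
    rw [← seg_concat z (!μ), ← e0, cyc]; simp
  rw [e1, List.isChain_append]
  refine ⟨isChain_arc _ _ _ _ _ _ (.inl rfl), isChain_seg _ _ _ _ _, ?_⟩
  rw [← List.cons_append, List.getLast?_concat, seg_succ]
  simp only [Option.mem_def, Option.some.injEq, List.head?_cons, forall_eq']
  rw [arcExit_true]
  exact .inr ⟨by simp, rfl, .inl (by simp [flip_flip])⟩

end CycleRAAG

namespace CycleRAAG

open TraceWord

variable {n : ℕ}

/-- The number of walls crossed at a junction. -/
def junctionCost (κ : Bool) : ℕ := if κ then 1 else 2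

lemma gdist_nextCh (κ : Bool) (k : A n) (z : ZMod n) (μ : Bool) :
    gdist (cycleGraph n) k (nextCh κ k z μ) ≤ junctionCost κ := by
  have h1 := gdist_flip (pos z μ 4) k
  have h2 := gdist_flip (pos z μ 3) (flip (pos z μ 4) k)
  have h3 := gdist_triangle k (flip (pos z μ 4) k) (flip (pos z μ 3) (flip (pos z μ 4) k))
  cases κ
  · simp only [nextCh, junctionCost, Bool.false_eq_true, if_false]; omega
  · simp only [nextCh, junctionCost, if_true]; omega

lemma gdist_arc {κ : Bool} {ks : List Bool} {k : A n} {z : ZMod n} {μ : Bool} {e : Ent n}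
    (he : e ∈ arc κ ks k z μ) :
    gdist (cycleGraph n) k e.ch ≤ (ks.map junctionCost).sum := by
  induction ks generalizing κ k z μ with
  | nil =>
    obtain ⟨i, -, -, rfl⟩ := mem_seg.1 he
    simp [gdist_self]
  | cons κ' ks ih =>
    have h1 := gdist_nextCh κ' k z μ
    simp only [arc, List.mem_cons, List.mem_append] at he
    simp only [List.map_cons, List.sum_cons]
    rcases he with rfl | rfl | he | rfl | he
    · simp [gdist_self]
    · simp [gdist_self]
    · have h2 := ih he
      have h3 := gdist_triangle k (nextCh κ' k z μ) e.ch
      omega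
    · simp only [arcExit]; omega
    · obtain ⟨i, -, -, rfl⟩ := mem_seg.1 he
      simp [gdist_self]

lemma gdist_cyc {ks : List Bool} {K : A n} {z : ZMod n} {μ : Bool} {e : Ent n}
    (he : e ∈ cyc ks K z μ) :
    gdist (cycleGraph n) K e.ch ≤ 1 + (ks.map junctionCost).sum := by
  have h1 := gdist_flip z K
  simp only [cyc, List.mem_cons, List.mem_append] at he
  rcases he with rfl | he | rfl | he
  · simp [gdist_self]
  · have h2 := gdist_arc he
    have h3 := gdist_triangle K (flip z K) e.ch
    omega
  · simp only [arcExit]; omega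
  · obtain ⟨i, -, -, rfl⟩ := mem_seg.1 he
    simp [gdist_self]

variable [hn : Fact (6 < n)]

lemma Level.height_nextCh {x : ZMod n} {μ₀ : Bool} {z : ZMod n} {μ : Bool} {K k : A n}
    (h : Level x μ₀ z μ (height x μ₀ K k)) (κ : Bool) :
    height x μ₀ K (nextCh κ k z μ) = height x μ₀ K k + 1 := by
  cases κ
  · simp only [nextCh, Bool.false_eq_true, if_false]
    rw [h.height_flip_three, h.height_flip_four]
  · simp only [nextCh, if_true]
    rw [h.height_flip_four]

lemma Level.nextCh_level {x : ZMod n} {μ₀ : Bool} {z : ZMod n} {μ : Bool} {K k : A n}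
    (h : Level x μ₀ z μ (height x μ₀ K k)) (κ : Bool) :
    Level x μ₀ (pos z μ 4) (!μ) (height x μ₀ K (nextCh κ k z μ)) := by
  rw [h.height_nextCh]
  exact h.next

lemma mem_arc_cases {x : ZMod n} {μ₀ : Bool} {κ : Bool} {ks : List Bool} {K k : A n} {z : ZMod n}
    {μ : Bool} (h : Level x μ₀ z μ (height x μ₀ K k)) {e : Ent n} (he : e ∈ arc κ ks k z μ) :
    (∃ i : ℕ, 2 ≤ i ∧ i ≤ top n κ ∧ e = ⟨pos z μ i, μ, k⟩) ∨
      height x μ₀ K k + 1 ≤ height x μ₀ K e.ch := by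
  have hn := hn.out
  have htop : 5 ≤ top n κ := by unfold top; split_ifs <;> omega
  induction ks generalizing κ k z μ with
  | nil =>
    obtain ⟨i, h1, h2, rfl⟩ := mem_seg.1 he
    exact .inl ⟨i, h1, by omega, rfl⟩
  | cons κ' ks ih =>
    have h1 := h.height_nextCh κ'
    simp only [arc, List.mem_cons, List.mem_append] at he
    rcases he with rfl | rfl | he | rfl | he
    · exact .inl ⟨2, le_rfl, by omega, rfl⟩
    · exact .inl ⟨3, by omega, by omega, rfl⟩
    · right
      have htop' : 5 ≤ top n κ' := by unfold top; split_ifs <;> omega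
      rcases ih (h.nextCh_level κ') he htop' with ⟨i, h2, h3, rfl⟩ | h2
      · exact h1.ge
      · omega
    · right
      exact h1.ge
    · obtain ⟨i, h2, h3, rfl⟩ := mem_seg.1 he
      refine .inl ⟨i, ?_, ?_, rfl⟩
      · have : 2 ≤ resume κ' := by unfold resume; split_ifs <;> omega
        omega
      · unfold resume at h2 h3; split_ifs at h2 h3 <;> omega

/-- The labels of an arc are not visible from lower chambers. -/
lemma arc_label_ne {x : ZMod n} {μ₀ : Bool} {κ : Bool} {ks : List Bool} {K k l : A n} {z : ZMod n}
    {μ : Bool} (h : Level x μ₀ z μ (height x μ₀ K k)) {e : Ent n} (he : e ∈ arc κ ks k z μ)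
    (hl : height x μ₀ K l < height x μ₀ K k)
    (hκ : κ = false → par (pos z μ 1) k ≠ par (pos z μ 1) l) :
    e.lab ≠ label e.typ l := by
  have hn := hn.out
  rcases mem_arc_cases h he with ⟨i, h1, h2, rfl⟩ | h1
  · simp only [Ent.lab]
    by_cases hi : i ≤ n - 2
    · apply h.label_ne hl
      have h3 := pos_not_mem_nbhd (z := z) (μ := μ) (a := 0) (b := i)
        (by rw [le_abs]; omega) (by rw [abs_le]; omega)
      rwa [pos_zero] at h3
    · have hκ' : κ = false := by
        cases κ
        · rfl
        · simp only [top, if_true] at h2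
          omega
      have hi' : i = n - 1 := by
        simp only [top, hκ', Bool.false_eq_true, if_false] at h2
        omega
      intro e
      refine hκ hκ' (par_eq_of_label_eq ?_ e)
      apply pos_not_mem_nbhd
      · rw [le_abs]; omega
      · rw [abs_le]; omega
  · intro e
    have := height_lt_add_two_of_label_eq (x := x) (μ := μ₀) (K := K) e.symm
    omega

lemma par_nextCh_false (k : A n) (z : ZMod n) (μ : Bool) :
    par (pos z μ 3) (nextCh false k z μ) ≠ par (pos z μ 3) k := by
  have hn := hn.out
  have h1 : pos z μ 4 ≠ pos z μ 3 := pos_ne (by omega) (by omega) (by omega)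
  have h2 : par (pos z μ 3) (flip (pos z μ 4) k) = par (pos z μ 3) k := par_bump_of_ne h1 _ _
  simp only [nextCh, Bool.false_eq_true, if_false]
  rw [flip, par_bump_self, h2]
  rcases zmod_two_cases (par (pos z μ 3) k) with h | h <;> rw [h] <;> decide

omit hn in
lemma label_flip {i j : ZMod n} (h : j ∈ nbhd i) (k : A n) : label i (flip j k) = label i k :=
  label_bump h _ _

lemma mem_nbhd_pos_of {z : ZMod n} {μ : Bool} {a b : ℤ} (h : a - b = 0 ∨ a - b = 1 ∨ a - b = -1) :
    pos z μ a ∈ nbhd (pos z μ b) := by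
  rw [mem_nbhd_pos]
  rcases h with h | h | h
  · left; congr 1; omega
  · right; left; congr 1; omega
  · right; right; congr 1; omega

lemma arcExit_lab (κ : Bool) (k : A n) (z : ZMod n) (μ : Bool) :
    (arcExit κ (nextCh κ k z μ) (pos z μ 4) (!μ)).lab =
      label (pos z μ (resume κ - 1 : ℕ)) k := by
  cases κ
  · rw [arcExit_false]
    simp only [Ent.lab, nextCh, Bool.false_eq_true, if_false, resume]
    rw [label_flip (mem_nbhd_pos_of (by norm_num)), label_flip (mem_nbhd_pos_of (by norm_num))]
    norm_num
  · rw [arcExit_true]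
    simp only [Ent.lab, nextCh, if_true, resume, pos_not, pos_pos]
    rw [label_flip (mem_nbhd_pos_of (by norm_num))]
    norm_num

omit hn in
lemma nodup_labels (z : ZMod n) (μ : Bool) (k : A n) (l : List ℕ) (hl : l.Nodup)
    (h : ∀ i ∈ l, 1 ≤ i ∧ i < n) : (l.map fun i : ℕ => label (pos z μ i) k).Nodup := by
  refine List.Nodup.map_on (fun i hi j hj e => ?_) hl
  by_contra hij
  have h1 := h i hi
  have h2 := h j hj
  exact pos_ne (by omega) (by omega) (by omega) (congrArg Prod.fst e)

omit hn in
lemma map_lab_seg (z : ZMod n) (μ : Bool) (k : A n) (a len : ℕ) :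
    (seg z μ k a len).map Ent.lab = (List.range' a len).map fun i : ℕ => label (pos z μ i) k := by
  simp [seg, Ent.lab]

omit hn in
lemma nodup_sandwich {α : Type*} {l₁ l₂ l₃ : List α} (h1 : l₂.Nodup) (h2 : (l₁ ++ l₃).Nodup)
    (h3 : ∀ a ∈ l₂, a ∉ l₁ ++ l₃) : (l₁ ++ (l₂ ++ l₃)).Nodup := by
  have h4 : (l₂ ++ (l₁ ++ l₃)).Nodup := List.nodup_append'.2 ⟨h1, h2, h3⟩
  refine (List.Perm.nodup_iff ?_).1 h4
  rw [← List.append_assoc, ← List.append_assoc]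
  exact List.perm_append_comm.append_right _

lemma arc_nodup {x : ZMod n} {μ₀ : Bool} {κ : Bool} {ks : List Bool} {K k : A n} {z : ZMod n}
    {μ : Bool} (h : Level x μ₀ z μ (height x μ₀ K k)) :
    ((arc κ ks k z μ).map Ent.lab).Nodup := by
  have hn := hn.out
  have htop : 5 ≤ top n κ ∧ top n κ < n := by unfold top; split_ifs <;> omega
  induction ks generalizing κ k z μ with
  | nil =>
    rw [arc, map_lab_seg]
    refine nodup_labels _ _ _ _ List.nodup_range' fun i hi => ?_
    rw [List.mem_range'_1] at hi
    omega
  | cons κ' ks ih =>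
    have e1 : (arc κ (κ' :: ks) k z μ).map Ent.lab =
        [2, 3].map (fun i : ℕ => label (pos z μ i) k) ++
          ((arc κ' ks (nextCh κ' k z μ) (pos z μ 4) (!μ)).map Ent.lab ++
          (List.range' (resume κ' - 1) (top n κ + 1 - resume κ' + 1)).map
            (fun i : ℕ => label (pos z μ i) k)) := by
      rw [List.range'_succ]
      simp only [arc, List.map_cons, List.map_append, arcExit_lab, map_lab_seg]
      rw [show resume κ' - 1 + 1 = resume κ' by unfold resume; split_ifs <;> rfl]
      rfl
    rw [e1]
    have htop' : 5 ≤ top n κ' ∧ top n κ' < n := by unfold top; split_ifs <;> omega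
    refine nodup_sandwich (ih (h.nextCh_level κ') htop') ?_ ?_
    · rw [← List.map_append]
      refine nodup_labels _ _ _ _ ?_ fun i hi => ?_
      · refine List.nodup_append'.2 ⟨by decide, List.nodup_range', ?_⟩
        intro i hi hi'
        rw [List.mem_range'_1] at hi'
        simp only [List.mem_cons, List.not_mem_nil, or_false] at hi
        unfold resume at hi'
        split_ifs at hi' <;> omega
      · rw [List.mem_append, List.mem_range'_1] at hi
        simp only [List.mem_cons, List.not_mem_nil, or_false] at hi
        unfold resume at hi
        split_ifs at hi <;> omega
    · intro a ha ha'
      rw [← List.map_append] at ha'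
      obtain ⟨e, he, rfl⟩ := List.mem_map.1 ha
      obtain ⟨i, -, hi⟩ := List.mem_map.1 ha'
      have h1 := arc_label_ne (l := k) (h.nextCh_level κ') he (by rw [h.height_nextCh]; omega) (by
        rintro rfl
        rw [pos_not, pos_pos]
        exact par_nextCh_false k z μ)
      have h2 : pos z μ i = e.typ := congrArg Prod.fst hi
      rw [h2] at hi
      exact h1 hi.symm

lemma level_flip (z : ZMod n) (μ : Bool) (K : A n) :
    Level z μ z μ (height z μ K (flip z K)) ∧ height z μ K (flip z K) = 1 := by
  have : height z μ K (flip z K) = 1 := by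
    rw [height_flip, height_self, heightPerm, if_pos rfl, swapUp_apply]; rfl
  exact ⟨.inl ⟨rfl, rfl, by rw [this]; rfl⟩, this⟩

/-- Vertices of the standard cycle outside the arc are visible from the base chamber. -/
lemma mem_cyc_cases {ks : List Bool} {K : A n} {z : ZMod n} {μ : Bool} {e : Ent n}
    (he : e ∈ cyc ks K z μ) : e ∈ arc true ks (flip z K) z μ ∨
      (∃ i : ℕ, 1 ≤ i ∧ i < n ∧ e.typ = pos z μ i) ∧ e.lab = label e.typ K := by
  have hn := hn.out
  simp only [cyc, List.mem_cons, List.mem_append] at he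
  rcases he with rfl | he | rfl | he
  · exact .inr ⟨⟨1, by omega, by omega, by simp⟩, rfl⟩
  · exact .inl he
  · refine .inr ⟨⟨n - 1, by omega, by omega, ?_⟩, ?_⟩
    · rw [arcExit, show top n true + 1 = n - 1 by simp only [top, if_true]; omega]
    · rw [arcExit_true, Ent.lab, label_flip]
      have := mem_nbhd_pos_of (z := z) (μ := μ) (a := 0) (b := -1) (by norm_num)
      rwa [pos_zero] at this
  · obtain ⟨i, h1, h2, rfl⟩ := mem_seg.1 he
    refine .inr ⟨⟨n - i, by omega, by omega, ?_⟩, rfl⟩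
    simp only [pos_not]
    rw [← pos_add_n z μ]; congr 1; omega

lemma cyc_nodup (ks : List Bool) (K : A n) (z : ZMod n) (μ : Bool) :
    ((cyc ks K z μ).map Ent.lab).Nodup := by
  have hn := hn.out
  have e1 : (cyc ks K z μ).map Ent.lab =
      [n - 1].map (fun i : ℕ => label (pos z (!μ) i) K) ++
        ((arc true ks (flip z K) z μ).map Ent.lab ++
        (List.range' 1 (n - 3 + 1)).map (fun i : ℕ => label (pos z (!μ) i) K)) := by
    rw [List.range'_succ]
    simp only [cyc, List.map_cons, List.map_append, map_lab_seg, List.map_nil, List.cons_append,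
      List.nil_append]
    refine congrArg₂ _ ?_ (congrArg₂ _ rfl (congrArg₂ _ ?_ rfl))
    · rw [Ent.lab, pos_not, ← pos_add_n z μ (-_)]
      rw [show -((n - 1 : ℕ) : ℤ) + n = 1 by omega]
    · rw [arcExit_true, Ent.lab, label_flip]
      · simp
      have := mem_nbhd_pos_of (z := z) (μ := μ) (a := 0) (b := -1) (by norm_num)
      rwa [pos_zero] at this
  rw [e1]
  refine nodup_sandwich (arc_nodup (level_flip z μ K).1) ?_ ?_
  · rw [← List.map_append]
    refine nodup_labels _ _ _ _ ?_ fun i hi => ?_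
    · refine List.nodup_append'.2 ⟨by simp, List.nodup_range', ?_⟩
      intro i hi hi'
      rw [List.mem_range'_1] at hi'
      simp only [List.mem_cons, List.not_mem_nil, or_false] at hi
      omega
    · rw [List.mem_append, List.mem_range'_1] at hi
      simp only [List.mem_cons, List.not_mem_nil, or_false] at hi
      omega
  · intro a ha ha'
    rw [← List.map_append] at ha'
    obtain ⟨e, he, rfl⟩ := List.mem_map.1 ha
    obtain ⟨i, -, hi⟩ := List.mem_map.1 ha'
    have h1 := arc_label_ne (l := K) (level_flip z μ K).1 he (by
      rw [(level_flip z μ K).2, height_self]; omega) (by simp)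
    have h2 : pos z (!μ) i = e.typ := congrArg Prod.fst hi
    rw [h2] at hi
    exact h1 hi.symm

/-- A vertex of the standard cycle adjacent to one of the labels at `z + 3 μ`, `z + 4 μ` seen from
the base chamber is visible from the base chamber. -/
lemma cyc_adj_of_three_four {ks : List Bool} {K : A n} {z : ZMod n} {μ : Bool} {e : Ent n}
    (he : e ∈ cyc ks K z μ) {a : ℤ} (ha : a = 3 ∨ a = 4)
    (h : (labelGraph n).Adj (label (pos z μ a) K) e.lab) :
    e.lab = label (pos z μ (a + 1)) K ∨ e.lab = label (pos z μ (a - 1)) K := by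
  have hn := hn.out
  obtain ⟨h1, l, h2, h3⟩ := h
  have h1' : e.typ = pos z μ (a + 1) ∨ e.typ = pos z μ (a - 1) := by
    have h1 : e.typ = _ ∨ e.typ = _ := (cycle_adj_iff_dir μ).1 h1
    simpa only [label, pos_add_dir, pos_sub_dir] using h1
  rcases mem_cyc_cases he with he | ⟨-, he⟩
  · exfalso
    have h4 : (height z μ K l + 1) / 2 = (height z μ K K + 1) / 2 := by
      refine height_add_div_eq_of_label_eq ?_ h2
      have h := pos_not_mem_nbhd (z := z) (μ := μ) (a := 0) (b := a)
        (by rw [le_abs]; omega) (by rw [abs_le]; omega)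
      rwa [pos_zero] at h
    rw [height_self] at h4
    refine arc_label_ne (l := l) (level_flip z μ K).1 he ?_ (by simp) h3
    rw [(level_flip z μ K).2]
    omega
  · rw [he]
    rcases h1' with h1' | h1' <;> simp [h1']

/-- A vertex of the standard cycle adjacent to the label at `z + μ` seen from
the base chamber is visible from the base chamber or its neighbour across `z`. -/
lemma cyc_adj_of_one {ks : List Bool} {K : A n} {z : ZMod n} {μ : Bool} {e : Ent n}
    (he : e ∈ cyc ks K z μ)
    (h : (labelGraph n).Adj (label (pos z μ 1) K) e.lab) :
    e.lab = label (pos z μ 2) K ∨ e.lab = label (pos z μ 2) (flip z K) := by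
  have hn := hn.out
  obtain ⟨h1, l, h2, h3⟩ := h
  have h1' : e.typ = pos z μ 2 ∨ e.typ = z := by
    have h1 : e.typ = _ ∨ e.typ = _ := (cycle_adj_iff_dir μ).1 h1
    simpa [label, pos_add_dir, pos_sub_dir] using h1
  have hlev := level_flip z μ K
  rcases mem_cyc_cases he with he | ⟨⟨i, h4, h5, h6⟩, he⟩
  · have h4 : height z μ K l / 2 = height z μ K K / 2 := by
      refine height_div_eq_of_label_eq ?_ h2
      exact pos_not_mem_nbhd (by rw [le_abs]; omega) (by rw [abs_le]; omega)
    rw [height_self] at h4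
    by_cases hl : height z μ K l < 1
    · exact (arc_label_ne (l := l) hlev.1 he (by rw [hlev.2]; exact hl) (by simp) h3).elim
    have hl1 : height z μ K l = 1 := by omega
    have h7 : height z μ K e.ch ≤ 1 := by
      have h3' : label e.typ e.ch = label e.typ l := h3
      rcases h1' with h1' | h1'
      · rw [h1'] at h3'
        have := height_eq_of_label_eq (K := K) (x := z) (μ := μ) (i := pos z μ 2) (by
          have h := pos_not_mem_nbhd (z := z) (μ := μ) (a := 0) (b := 2)
            (by rw [le_abs]; omega) (by rw [abs_le]; omega)
          rwa [pos_zero] at h) (pos_not_mem_nbhd (by rw [le_abs]; omega) (by rw [abs_le]; omega)) h3'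
        omega
      · rw [h1'] at h3'
        have := height_div_eq_of_label_eq (K := K) (x := z) (μ := μ) (i := z) (by
          have h := pos_not_mem_nbhd (z := z) (μ := μ) (a := 4) (b := 0)
            (by rw [le_abs]; omega) (by rw [abs_le]; omega)
          rwa [pos_zero] at h) h3'
        omega
    rcases mem_arc_cases hlev.1 he with ⟨i, h8, h9, rfl⟩ | h8
    · right
      rcases h1' with h1' | h1'
      · simp only at h1'
        rw [Ent.lab, h1']
      · exfalso
        simp only [top, if_true] at h9
        rw [← pos_zero z μ, pos_pos] at h1'
        exact pos_ne (by omega) (by omega) (by omega) h1'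
    · rw [hlev.2] at h8; omega
  · left
    rw [he]
    rcases h1' with h1' | h1'
    · rw [h1']
    · exfalso
      rw [h1', ← pos_zero z μ, pos_pos] at h6
      exact pos_ne (by omega) (by omega) (by omega) h6

end CycleRAAG

namespace CycleRAAG

open TraceWord

variable {n : ℕ}

/-- The length of the standard cycle with given junctions. -/
def cycLen (n : ℕ) (ks : List Bool) : ℕ := 2 * n - 4 + (ks.map (junctionLength n)).sum

lemma Near.label_eq {i : ZMod n} {E E' : A n} (h : Near i E E') {j : ZMod n} (hj : i ∈ nbhd j) :
    label j E' = label j E := by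
  rcases h with rfl | rfl
  · rfl
  · exact label_flip hj _

lemma Near.shift_eq {i : ZMod n} {E E' : A n} (h : Near i E E') (ε : Bool) :
    shift i ε E' = shift i ε E := by
  rcases h with rfl | rfl
  · rfl
  · exact shift_flip _ _ _

lemma Near.labelMap_eq {i : ZMod n} {E E' : A n} (h : Near i E E') :
    labelMap E' = labelMap E := by
  rcases h with rfl | rfl
  · rfl
  · exact labelMap_flip _ _

lemma Step.labelMap_eq {e e' : Ent n} (h : Step e e') : labelMap e'.ch = labelMap e.ch := by
  rcases h with ⟨-, -, h⟩ | ⟨-, -, h⟩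
  · exact h.labelMap_eq
  · rw [h.labelMap_eq, labelMap_flip]

lemma Step.typ_eq {e e' : Ent n} (h : Step e e') : e.typ = pos e'.typ e'.d (-1) := by
  rcases h with ⟨h1, h2, -⟩ | ⟨h1, h2, -⟩ <;> simp [h1, h2]

variable [hn : Fact (6 < n)]

omit hn in
lemma self_mem_nbhd (i : ZMod n) : i ∈ nbhd i := .inl rfl

lemma pos_one_mem_nbhd (i : ZMod n) (d : Bool) : pos i d 1 ∈ nbhd i := by
  have := mem_nbhd_pos_of (z := i) (μ := d) (a := 1) (b := 0) (by norm_num)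
  rwa [pos_zero] at this

lemma adj_pos_one (i : ZMod n) (d : Bool) : (cycleGraph n).Adj i (pos i d 1) := by
  have := cycle_adj_add i d
  rwa [← pos_zero i d, pos_add_dir, zero_add, pos_zero] at this

lemma Step.adj_typ {e e' : Ent n} (h : Step e e') : (cycleGraph n).Adj e.typ e'.typ := by
  have := adj_pos_one (pos e'.typ e'.d (-1)) e'.d
  rw [pos_pos] at this
  rw [h.typ_eq]
  simpa using this

/-- The label of a vertex is visible from the next chamber. -/
lemma Step.lab_eq {e e' : Ent n} (h : Step e e') : e.lab = label e.typ e'.ch := by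
  rcases h with ⟨-, -, h⟩ | ⟨-, -, h⟩
  · rw [h.label_eq (self_mem_nbhd _), Ent.lab]
  · rw [h.label_eq (self_mem_nbhd _), label_flip (pos_one_mem_nbhd _ _), Ent.lab]

lemma lt_cycLen (ks : List Bool) : 6 < cycLen n ks := by
  have := hn.out
  unfold cycLen
  omega

instance (ks : List Bool) : Fact (6 < cycLen n ks) := ⟨lt_cycLen ks⟩

instance (ks : List Bool) : NeZero (cycLen n ks) := ⟨by have := lt_cycLen (n := n) ks; omega⟩

lemma length_cyc (ks : List Bool) (K : A n) (z : ZMod n) (μ : Bool) :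
    (cyc ks K z μ).length = cycLen n ks := cyc_length ks K z μ

/-- The standard cycle, as a cyclic sequence. -/
noncomputable def cycEnt (ks : List Bool) (K : A n) (z : ZMod n) (μ : Bool)
    (i : ZMod (cycLen n ks)) : Ent n :=
  (cyc ks K z μ)[i.val]'(by rw [length_cyc]; exact ZMod.val_lt i)

section

variable (ks : List Bool) (K : A n) (z : ZMod n) (μ : Bool)

lemma cycEnt_mem (i : ZMod (cycLen n ks)) : cycEnt ks K z μ i ∈ cyc ks K z μ :=
  List.getElem_mem _

lemma cycEnt_natCast {j : ℕ} (hj : j < cycLen n ks) :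
    cycEnt ks K z μ j = (cyc ks K z μ)[j]'(by rwa [length_cyc]) := by
  simp only [cycEnt, ZMod.val_natCast, Nat.mod_eq_of_lt hj]

lemma cycEnt_zero : cycEnt ks K z μ 0 = ⟨pos z μ 1, !μ, K⟩ := by
  have := cycEnt_natCast ks K z μ (j := 0) (by have := lt_cycLen (n := n) ks; omega)
  rw [Nat.cast_zero] at this
  rw [this]
  rfl

lemma step_cycEnt (i : ZMod (cycLen n ks)) :
    Step (cycEnt ks K z μ i) (cycEnt ks K z μ (i + 1)) := by
  have h := List.isChain_iff_getElem.1 (isChain_cyc ks K z μ)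
  obtain ⟨j, hj, rfl⟩ : ∃ j < cycLen n ks, (j : ZMod (cycLen n ks)) = i :=
    ⟨i.val, ZMod.val_lt i, ZMod.natCast_zmod_val i⟩
  have hl := length_cyc ks K z μ
  have h1 := h j (by simp [hl]; omega)
  rw [List.getElem_append_left (by omega)] at h1
  rw [cycEnt_natCast ks K z μ hj, ← Nat.cast_add_one]
  by_cases hj' : j + 1 < cycLen n ks
  · rw [List.getElem_append_left (by omega)] at h1
    rw [cycEnt_natCast ks K z μ hj']
    exact h1
  · have h2 : j + 1 = cycLen n ks := by omega
    rw [List.getElem_append_right (by omega)] at h1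
    rw [h2, ZMod.natCast_self, cycEnt_zero]
    simpa using h1

lemma lab_cycEnt_injective : Function.Injective fun i => (cycEnt ks K z μ i).lab := by
  intro i j h
  have h1 := cyc_nodup ks K z μ
  have h2 : ((cyc ks K z μ).map Ent.lab)[i.val]'(by
      rw [List.length_map, length_cyc]; exact ZMod.val_lt i) =
      ((cyc ks K z μ).map Ent.lab)[j.val]'(by
      rw [List.length_map, length_cyc]; exact ZMod.val_lt j) := by
    simp only [List.getElem_map]
    exact h
  exact ZMod.val_injective _ ((List.Nodup.getElem_inj_iff h1).1 h2)

lemma gdist_cycEnt (i : ZMod (cycLen n ks)) :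
    gdist (cycleGraph n) K (cycEnt ks K z μ i).ch ≤ 1 + (ks.map junctionCost).sum :=
  gdist_cyc (cycEnt_mem ks K z μ i)

lemma labelMap_cycEnt (i : ZMod (cycLen n ks)) : labelMap (cycEnt ks K z μ i).ch = labelMap K := by
  obtain ⟨j, rfl⟩ : ∃ j : ℕ, (j : ZMod (cycLen n ks)) = i := ⟨i.val, ZMod.natCast_zmod_val i⟩
  induction j with
  | zero => rw [Nat.cast_zero, cycEnt_zero]
  | succ j ih => rw [Nat.cast_succ, (step_cycEnt ks K z μ j).labelMap_eq, ih]

lemma exists_arc_eq (κ : Bool) (k : A n) :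
    ∃ l, arc κ ks k z μ = ⟨pos z μ 2, μ, k⟩ :: ⟨pos z μ 3, μ, k⟩ :: l := by
  have hn := hn.out
  cases ks with
  | nil =>
    obtain ⟨c, hc⟩ : ∃ c, top n κ - 1 = c + 1 + 1 :=
      ⟨top n κ - 3, by unfold top; split_ifs <;> omega⟩
    rw [arc, hc, seg_succ, seg_succ]
    exact ⟨_, rfl⟩
  | cons κ' ks => exact ⟨_, rfl⟩

lemma cycEnt_one : cycEnt ks K z μ 1 = ⟨pos z μ 2, μ, flip z K⟩ := by
  have := cycEnt_natCast ks K z μ (j := 1) (by have := lt_cycLen (n := n) ks; omega)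
  rw [Nat.cast_one] at this
  obtain ⟨l, hl⟩ := exists_arc_eq ks z μ true (flip z K)
  rw [this]
  simp only [cyc, hl]
  rfl

lemma cycEnt_two : cycEnt ks K z μ 2 = ⟨pos z μ 3, μ, flip z K⟩ := by
  have := cycEnt_natCast ks K z μ (j := 2) (by have := lt_cycLen (n := n) ks; omega)
  rw [Nat.cast_ofNat] at this
  obtain ⟨l, hl⟩ := exists_arc_eq ks z μ true (flip z K)
  rw [this]
  simp only [cyc, hl]
  rfl

/-- Away from the arc, the standard cycle stays in its base chamber. -/
lemma cycEnt_neg {a : ℕ} (ha : 1 ≤ a) (ha' : a + 3 ≤ n) :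
    cycEnt ks K z μ (-a) = ⟨pos z μ (a + 1), !μ, K⟩ := by
  have hn := hn.out
  have hl := length_cyc ks K z μ
  have hlen : cycLen n ks = (arc true ks (flip z K) z μ).length + 1 + 1 + (n - 3) := by
    rw [← hl]; simp [cyc]; omega
  have e1 : (-a : ZMod (cycLen n ks)) = ((cycLen n ks - a : ℕ) : ZMod (cycLen n ks)) := by
    rw [Nat.cast_sub (by omega), ZMod.natCast_self, zero_sub]
  rw [e1, cycEnt_natCast ks K z μ (by omega)]
  have e2 : cyc ks K z μ = (⟨pos z μ 1, !μ, K⟩ :: (arc true ks (flip z K) z μ ++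
      [arcExit true (flip z K) z μ])) ++ seg z (!μ) K 2 (n - 3) := by simp [cyc]
  rw [List.getElem_of_eq e2, List.getElem_append_right (by simp; omega)]
  simp only [seg, List.getElem_map, List.getElem_range', pos_not]
  rw [Ent.mk.injEq, ← pos_add_n z μ (-_)]
  refine ⟨?_, rfl, rfl⟩
  congr 1
  simp only [List.length_cons, List.length_append, List.length_nil]
  push_cast [Int.natCast_sub]
  omega

lemma not_adj_cycEnt_zero {j : ZMod (cycLen n ks)} (h1 : j ≠ 1) (h2 : j ≠ -1) :
    ¬(labelGraph n).Adj (cycEnt ks K z μ 0).lab (cycEnt ks K z μ j).lab := by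
  intro h
  have hn := hn.out
  rw [cycEnt_zero] at h
  rcases cyc_adj_of_one (cycEnt_mem ks K z μ j) h with h | h
  · apply h2
    apply lab_cycEnt_injective ks K z μ
    have := cycEnt_neg ks K z μ (a := 1) le_rfl (by omega)
    rw [Nat.cast_one] at this
    beta_reduce
    rw [h, this]
    norm_num [Ent.lab]
  · apply h1
    apply lab_cycEnt_injective ks K z μ
    beta_reduce
    rw [h, cycEnt_one, Ent.lab]

lemma not_adj_cycEnt_neg {a : ℕ} (ha : a = 2 ∨ a = 3) {j : ZMod (cycLen n ks)} (h1 : j ≠ -a + 1)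
    (h2 : j ≠ -a - 1) :
    ¬(labelGraph n).Adj (cycEnt ks K z μ (-a)).lab (cycEnt ks K z μ j).lab := by
  intro h
  have hn := hn.out
  rw [cycEnt_neg ks K z μ (by omega) (by omega)] at h
  rcases cyc_adj_of_three_four (cycEnt_mem ks K z μ j) (a := a + 1) (by omega) h with h | h
  · apply h2
    apply lab_cycEnt_injective ks K z μ
    beta_reduce
    have := cycEnt_neg ks K z μ (a := a + 1) (by omega) (by omega)
    rw [Nat.cast_add_one] at this
    rw [h, ← neg_add', this]
    simp [Ent.lab]
  · apply h1
    apply lab_cycEnt_injective ks K z μ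
    obtain ⟨b, rfl⟩ : ∃ b, a = b + 1 := ⟨a - 1, by omega⟩
    beta_reduce
    have e : (-((b + 1 : ℕ) : ZMod (cycLen n ks)) + 1) = -b := by push_cast; ring
    rw [h, e, cycEnt_neg ks K z μ (by omega) (by omega)]
    simp [Ent.lab]

lemma straight_cycEnt_one : Straight (cycEnt ks K z μ 1) (cycEnt ks K z μ 2) := by
  rw [cycEnt_one, cycEnt_two]
  exact ⟨by simp, rfl, .inl rfl⟩

lemma straight_cycEnt_neg_one : Straight (cycEnt ks K z μ (-1)) (cycEnt ks K z μ 0) := by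
  have := cycEnt_neg ks K z μ (a := 1) le_rfl (by have := hn.out; omega)
  rw [Nat.cast_one] at this
  rw [this, cycEnt_zero]
  exact ⟨by simp, rfl, .inl rfl⟩

lemma straight_cycEnt_neg {a : ℕ} (ha : 1 ≤ a) (ha' : a + 4 ≤ n) :
    Straight (cycEnt ks K z μ (-(a + 1))) (cycEnt ks K z μ (-a)) := by
  rw [← Nat.cast_add_one, cycEnt_neg ks K z μ (by omega) (by omega),
    cycEnt_neg ks K z μ ha (by omega)]
  exact ⟨by simp, rfl, .inl rfl⟩

end

end CycleRAAG

namespace CycleRAAG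

open TraceWord

variable {n : ℕ} {ks : List Bool}

/-- A state: a framed standard cycle, and the last letters of the word read so far. -/
structure State (n : ℕ) (ks : List Bool) where
  /-- the base chamber -/
  K : A n
  /-- the base vertex -/
  z : ZMod n
  /-- the base direction -/
  μ : Bool
  /-- the rotation of the standard cycle -/
  t : ZMod (cycLen n ks)
  /-- the letters -/
  S : Set (ZMod (cycLen n ks))

/-- The frame in which the vertex `u` is passed straight, far away from the arc. -/
def straightAt (u : ZMod (cycLen n ks)) (e : Ent n) (k : A n) (S : Set (ZMod (cycLen n ks))) :
    State n ks := ⟨k, pos e.typ e.d 3, !e.d, u + 2, S⟩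

/-- The frame in which there is a fold at the vertex `u`. -/
def foldAt (u : ZMod (cycLen n ks)) (e : Ent n) (k : A n) (S : Set (ZMod (cycLen n ks))) :
    State n ks := ⟨k, pos e.typ e.d 1, !e.d, u, S⟩

variable [hn : Fact (6 < n)]

namespace State

/-- The vertex of the framed standard cycle at a vertex of the source cycle. -/
noncomputable def ent (s : State n ks) (u : ZMod (cycLen n ks)) : Ent n :=
  cycEnt ks s.K s.z s.μ (u - s.t)

/-- The label of a vertex of the source cycle. -/
noncomputable def lab (s : State n ks) (u : ZMod (cycLen n ks)) : ZMod n × Set (A n) :=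
  (s.ent u).lab

/-- The chamber after reading a letter. -/
noncomputable def nextChamber (s : State n ks) (u : ZMod (cycLen n ks)) (ε : Bool) (k : A n) : A n :=
  shift (s.ent u).typ ε k

open Classical in
/-- The state after reading a letter. -/
noncomputable def step (s : State n ks) (u : ZMod (cycLen n ks)) (ε : Bool) : State n ks :=
  if u + 1 ∈ s.S then
    straightAt (u + 1) (s.ent (u + 1)) (s.nextChamber u ε (s.ent (u + 1)).ch) {u, u + 1}
  else if u - 1 ∈ s.S then
    straightAt u (s.ent u) (s.nextChamber u ε (s.ent u).ch) {u - 1, u}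
  else if (s.ent (u + 1)).d = (s.ent u).d then
    straightAt u (s.ent u) (s.nextChamber u ε (s.ent u).ch) {u}
  else
    foldAt u (s.ent u) (s.nextChamber u ε (s.ent u).ch) {u}

/-- The standard cycle passes straight around the letters of the state, and their labels have
only the obvious neighbours. -/
def Good (s : State n ks) : Prop :=
  ∀ w ∈ s.S, Straight (s.ent (w - 1)) (s.ent w) ∧ Straight (s.ent (w + 1)) (s.ent (w + 2)) ∧
    ∀ u, u ≠ w + 1 → u ≠ w - 1 → ¬(labelGraph n).Adj (s.lab w) (s.lab u)

lemma step_ent (s : State n ks) (u : ZMod (cycLen n ks)) : Step (s.ent u) (s.ent (u + 1)) := by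
  have := step_cycEnt ks s.K s.z s.μ (u - s.t)
  rwa [sub_add_eq_add_sub] at this

lemma step_ent_sub (s : State n ks) (u : ZMod (cycLen n ks)) :
    Step (s.ent (u - 1)) (s.ent u) := by
  have := s.step_ent (u - 1)
  rwa [sub_add_cancel] at this

lemma lab_injective (s : State n ks) : Function.Injective s.lab := by
  intro u v h
  exact sub_left_injective (lab_cycEnt_injective ks s.K s.z s.μ h)

lemma gdist_ent (s : State n ks) (u : ZMod (cycLen n ks)) :
    gdist (cycleGraph n) s.K (s.ent u).ch ≤ 1 + (ks.map junctionCost).sum :=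
  gdist_cycEnt ks s.K s.z s.μ _

lemma labelMap_ent (s : State n ks) (u : ZMod (cycLen n ks)) :
    labelMap (s.ent u).ch = labelMap s.K := labelMap_cycEnt ks s.K s.z s.μ _

lemma lab_eq_sub (s : State n ks) (u : ZMod (cycLen n ks)) :
    s.lab (u - 1) = label (pos (s.ent u).typ (s.ent u).d (-1)) (s.ent u).ch := by
  have h := s.step_ent_sub u
  rw [lab, h.lab_eq, h.typ_eq]

end State

section frames

variable (u : ZMod (cycLen n ks)) (e : Ent n) (k : A n) (S : Set (ZMod (cycLen n ks)))

lemma ent_straightAt : (straightAt u e k S).ent u = ⟨e.typ, e.d, k⟩ := by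
  have h := cycEnt_neg ks k (pos e.typ e.d 3) (!e.d) (a := 2) (by norm_num)
    (by have := hn.out; omega)
  rw [State.ent, straightAt, sub_add_cancel_left]
  simpa using h

lemma ent_straightAt_add_one :
    (straightAt u e k S).ent (u + 1) = ⟨pos e.typ e.d 1, e.d, k⟩ := by
  have h := cycEnt_neg ks k (pos e.typ e.d 3) (!e.d) (a := 1) le_rfl
    (by have := hn.out; omega)
  rw [State.ent, straightAt]
  dsimp only
  rw [show u + 1 - (u + 2) = -((1 : ℕ) : ZMod (cycLen n ks)) by push_cast; ring, h]
  simp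

lemma ent_straightAt_sub_one :
    (straightAt u e k S).ent (u - 1) = ⟨pos e.typ e.d (-1), e.d, k⟩ := by
  have h := cycEnt_neg ks k (pos e.typ e.d 3) (!e.d) (a := 3) (by norm_num)
    (by have := hn.out; omega)
  rw [State.ent, straightAt]
  dsimp only
  rw [show u - 1 - (u + 2) = -((3 : ℕ) : ZMod (cycLen n ks)) by push_cast; ring, h]
  simp

lemma ent_foldAt : (foldAt u e k S).ent u = ⟨e.typ, e.d, k⟩ := by
  have h := cycEnt_zero ks k (pos e.typ e.d 1) (!e.d)
  rw [State.ent, foldAt, sub_self]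
  simpa using h

lemma ent_foldAt_add_one : (foldAt u e k S).ent (u + 1) =
    ⟨pos e.typ e.d (-1), !e.d, flip (pos e.typ e.d 1) k⟩ := by
  have h := cycEnt_one ks k (pos e.typ e.d 1) (!e.d)
  rw [State.ent, foldAt, add_sub_cancel_left]
  simpa using h

lemma straightAt_straight {a b : ZMod (cycLen n ks)} (c : ℕ) (hc : c ≤ 3)
    (ha : a = u + 1 - c) (hb : b = u + 2 - c) :
    Straight ((straightAt u e k S).ent a) ((straightAt u e k S).ent b) := by
  subst ha hb
  rw [State.ent, State.ent, straightAt]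
  dsimp only
  rcases Nat.eq_zero_or_pos c with rfl | h
  · have := straight_cycEnt_neg_one ks k (pos e.typ e.d 3) (!e.d)
    convert this using 2 <;> push_cast <;> ring
  · have := straight_cycEnt_neg ks k (pos e.typ e.d 3) (!e.d) (a := c) h
      (by have := hn.out; omega)
    convert this using 2 <;> ring

lemma good_straightAt (h : S ⊆ {u - 1, u}) : (straightAt u e k S).Good := by
  intro w hw
  rcases h hw with rfl | rfl
  · refine ⟨straightAt_straight u e k S 3 le_rfl ?_ ?_,
      straightAt_straight u e k S 1 (by norm_num) ?_ ?_, fun v h1 h2 => ?_⟩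
    · push_cast; ring
    · push_cast; ring
    · push_cast; ring
    · push_cast; ring
    · have := not_adj_cycEnt_neg ks k (pos e.typ e.d 3) (!e.d) (a := 3) (.inr rfl)
        (j := v - (u + 2)) (fun h => h1 ?_) (fun h => h2 ?_)
      · have e1 : (straightAt u e k S).lab (u - 1) =
            (cycEnt ks k (pos e.typ e.d 3) (!e.d) (-(3 : ℕ))).lab := by
          rw [State.lab, State.ent, straightAt]
          dsimp only
          congr 2
          push_cast
          ring
        rw [e1]
        exact this
      · rw [sub_eq_iff_eq_add.1 h]; push_cast; ring
      · rw [sub_eq_iff_eq_add.1 h]; push_cast; ring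
  · refine ⟨straightAt_straight w e k S 2 (by norm_num) ?_ ?_,
      straightAt_straight w e k S 0 (by norm_num) ?_ ?_, fun v h1 h2 => ?_⟩
    · push_cast; ring
    · push_cast; ring
    · push_cast; ring
    · push_cast; ring
    · have := not_adj_cycEnt_neg ks k (pos e.typ e.d 3) (!e.d) (a := 2) (.inl rfl)
        (j := v - (w + 2)) (fun h => h1 ?_) (fun h => h2 ?_)
      · have e1 : (straightAt w e k S).lab (w) =
            (cycEnt ks k (pos e.typ e.d 3) (!e.d) (-(2 : ℕ))).lab := by
          rw [State.lab, State.ent, straightAt]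
          dsimp only
          congr 2
          push_cast
          ring
        rw [e1]
        exact this
      · rw [sub_eq_iff_eq_add.1 h]; push_cast; ring
      · rw [sub_eq_iff_eq_add.1 h]; push_cast; ring

lemma good_foldAt : (foldAt u e k {u}).Good := by
  rintro w rfl
  refine ⟨?_, ?_, fun v h1 h2 => ?_⟩
  · have := straight_cycEnt_neg_one ks k (pos e.typ e.d 1) (!e.d)
    rw [State.ent, State.ent, foldAt]
    dsimp only
    convert this using 2 <;> ring
  · have := straight_cycEnt_one ks k (pos e.typ e.d 1) (!e.d)
    rw [State.ent, State.ent, foldAt]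
    dsimp only
    convert this using 2 <;> ring
  · have := not_adj_cycEnt_zero ks k (pos e.typ e.d 1) (!e.d) (j := v - w)
      (fun h => h1 ?_) (fun h => h2 ?_)
    · have e1 : (foldAt w e k {w}).lab w = (cycEnt ks k (pos e.typ e.d 1) (!e.d) 0).lab := by
        rw [State.lab, State.ent, foldAt]
        dsimp only
        rw [sub_self]
      rw [e1]
      exact this
    · rw [sub_eq_iff_eq_add.1 h]; ring
    · rw [sub_eq_iff_eq_add.1 h]; ring

end frames

namespace State

lemma good_step (s : State n ks) (u : ZMod (cycLen n ks)) (ε : Bool) : (s.step u ε).Good := by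
  unfold step
  split_ifs
  · exact good_straightAt _ _ _ _ (by simp)
  · exact good_straightAt _ _ _ _ le_rfl
  · exact good_straightAt _ _ _ _ (by simp)
  · exact good_foldAt _ _ _

/-- Reading the letter `u` moves the vertex `u` along its own line. -/
lemma ent_step_self {s : State n ks} (hs : s.Good) (u : ZMod (cycLen n ks)) (ε : Bool) :
    (s.step u ε).ent u =
      ⟨(s.ent u).typ, (s.ent u).d, s.nextChamber u ε (s.ent u).ch⟩ := by
  unfold step
  split_ifs with h1 h2 h3
  · have h4 := (hs _ h1).1
    rw [add_sub_cancel_right] at h4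
    have h5 := ent_straightAt_sub_one (u + 1) (s.ent (u + 1))
      (s.nextChamber u ε (s.ent (u + 1)).ch) {u, u + 1}
    rw [add_sub_cancel_right] at h5
    rw [h5, h4.1, h4.2.1, nextChamber, h4.2.2.shift_eq, nextChamber]
    simp
  · exact ent_straightAt _ _ _ _
  · exact ent_straightAt _ _ _ _
  · exact ent_foldAt _ _ _ _

/-- Reading the letter `u` moves the vertex `u + 1` along the line of `u`. -/
lemma ent_step_add_one {s : State n ks} (hs : s.Good) (u : ZMod (cycLen n ks)) (ε : Bool) :
    (s.step u ε).ent (u + 1) =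
      ⟨(s.ent (u + 1)).typ, (s.ent (u + 1)).d, s.nextChamber u ε (s.ent (u + 1)).ch⟩ := by
  have key : Straight (s.ent u) (s.ent (u + 1)) → ∀ S,
      (straightAt u (s.ent u) (s.nextChamber u ε (s.ent u).ch) S).ent (u + 1) =
      ⟨(s.ent (u + 1)).typ, (s.ent (u + 1)).d, s.nextChamber u ε (s.ent (u + 1)).ch⟩ := by
    intro h S
    rw [ent_straightAt_add_one, h.1, h.2.1, nextChamber, nextChamber, h.2.2.shift_eq]
  unfold step
  split_ifs with h1 h2 h3
  · exact ent_straightAt _ _ _ _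
  · have h4 := (hs _ h2).2.1
    rw [sub_add_cancel, show u - 1 + 2 = u + 1 by ring] at h4
    exact key h4 _
  · refine key ((s.step_ent u).resolve_right fun h => ?_) _
    rw [h.2.1] at h3
    simp at h3
  · have h := (s.step_ent u).resolve_left fun h => h3 h.2.1
    rw [ent_foldAt_add_one, h.1, h.2.1, nextChamber, nextChamber, h.2.2.shift_eq]
    rw [shift, flip, flip, shift, bump_comm (adj_pos_one _ _)]

lemma lab_step_self {s : State n ks} (hs : s.Good) (u : ZMod (cycLen n ks)) (ε : Bool) :
    (s.step u ε).lab u = s.lab u := by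
  rw [lab, ent_step_self hs, Ent.lab, nextChamber, shift, label_bump (self_mem_nbhd _)]
  rfl

lemma lab_step_add_one {s : State n ks} (hs : s.Good) (u : ZMod (cycLen n ks)) (ε : Bool) :
    (s.step u ε).lab (u + 1) = s.lab (u + 1) := by
  rw [lab, ent_step_add_one hs, Ent.lab, nextChamber, shift,
    label_bump (.inr (s.step_ent u).adj_typ.symm)]
  rfl

lemma lab_step_sub_one {s : State n ks} (hs : s.Good) (u : ZMod (cycLen n ks)) (ε : Bool) :
    (s.step u ε).lab (u - 1) = s.lab (u - 1) := by
  rw [lab_eq_sub, lab_eq_sub, ent_step_self hs]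
  dsimp only
  rw [nextChamber, shift, label_bump]
  have := (s.step_ent_sub u).adj_typ
  rw [(s.step_ent_sub u).typ_eq] at this
  exact .inr this

lemma lab_step_adj {s : State n ks} (hs : s.Good) {u v : ZMod (cycLen n ks)}
    (h : (cycleGraph (cycLen n ks)).Adj u v) (ε : Bool) :
    (s.step u ε).lab v = s.lab v := by
  rcases cycle_adj_iff.1 h with rfl | rfl
  · exact lab_step_add_one hs u ε
  · exact lab_step_sub_one hs u ε

lemma step_S (s : State n ks) (u : ZMod (cycLen n ks)) (ε : Bool) :
    u ∈ (s.step u ε).S ∧ (s.step u ε).S ⊆ {u - 1, u, u + 1} := by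
  unfold step
  split_ifs
  · simp [straightAt]
  · simp [straightAt, Set.insert_subset_iff]
  · simp [straightAt]
  · simp [foldAt]

lemma step_eq_of_mem {s : State n ks} {u : ZMod (cycLen n ks)} (h : u + 1 ∈ s.S) (ε : Bool) :
    s.step u ε =
      straightAt (u + 1) (s.ent (u + 1)) (s.nextChamber u ε (s.ent (u + 1)).ch) {u, u + 1} := by
  rw [step, if_pos h]

lemma step_eq_of_sub_mem {s : State n ks} {u : ZMod (cycLen n ks)} (h : u + 1 ∉ s.S)
    (h' : u - 1 ∈ s.S) (ε : Bool) :
    s.step u ε = straightAt u (s.ent u) (s.nextChamber u ε (s.ent u).ch) {u - 1, u} := by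
  rw [step, if_neg h, if_pos h']

lemma add_two_not_mem_step (s : State n ks) (u : ZMod (cycLen n ks)) (ε : Bool) :
    u + 1 + 1 ∉ (s.step u ε).S := by
  intro h
  have hm := lt_cycLen (n := n) ks
  have key : ∀ c : ℤ, c ≠ 0 → |c| < 6 → (c : ZMod (cycLen n ks)) ≠ 0 := fun c h0 h1 =>
    intCast_ne_zero h0 (by omega)
  rcases (s.step_S u ε).2 h with h | h | h
  · refine key 3 (by norm_num) (by norm_num) ?_
    push_cast
    linear_combination h
  · refine key 2 (by norm_num) (by norm_num) ?_
    push_cast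
    linear_combination h
  · refine key 1 (by norm_num) (by norm_num) ?_
    push_cast
    have h : u + 1 + 1 = u + 1 := h
    linear_combination h

/-- Commuting letters may be read in any order. -/
lemma step_comm_add_one {s : State n ks} (hs : s.Good) (u : ZMod (cycLen n ks)) (ε ε' : Bool) :
    (s.step u ε).step (u + 1) ε' = (s.step (u + 1) ε').step u ε := by
  rw [step_eq_of_sub_mem (s.add_two_not_mem_step u ε)
    (by rw [add_sub_cancel_right]; exact (s.step_S u ε).1),
    step_eq_of_mem (s.step_S (u + 1) ε').1]
  have h1 : ((s.step (u + 1) ε').ent u).typ = (s.ent u).typ := by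
    rw [(State.step_ent _ u).typ_eq, ent_step_self hs, (s.step_ent u).typ_eq]
  rw [ent_step_add_one hs, ent_step_self hs (u + 1)]
  simp only [straightAt, nextChamber, add_sub_cancel_right, h1, ent_step_add_one hs]
  rw [shift, shift, shift, shift, bump_comm (s.step_ent u).adj_typ]

lemma step_comm {s : State n ks} (hs : s.Good) {u v : ZMod (cycLen n ks)}
    (h : (cycleGraph (cycLen n ks)).Adj u v) (ε ε' : Bool) :
    (s.step u ε).step v ε' = (s.step v ε').step u ε := by
  rcases cycle_adj_iff.1 h with rfl | rfl
  · exact step_comm_add_one hs u ε ε'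
  · have := step_comm_add_one hs (u - 1) ε' ε
    rw [sub_add_cancel] at this
    exact this.symm

lemma exists_step_K (s : State n ks) (u : ZMod (cycLen n ks)) (ε : Bool) :
    ∃ v, (s.step u ε).K = s.nextChamber u ε (s.ent v).ch ∧
      s.lab u = label (s.ent u).typ (s.ent v).ch := by
  unfold step
  split_ifs
  · exact ⟨u + 1, rfl, (s.step_ent u).lab_eq⟩
  · exact ⟨u, rfl, rfl⟩
  · exact ⟨u, rfl, rfl⟩
  · exact ⟨u, rfl, rfl⟩

lemma gdist_step (s : State n ks) (u : ZMod (cycLen n ks)) (ε : Bool) :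
    gdist (cycleGraph n) s.K (s.step u ε).K ≤ 1 + (ks.map junctionCost).sum + 2 := by
  obtain ⟨v, h, -⟩ := s.exists_step_K u ε
  rw [h]
  exact (gdist_triangle _ (s.ent v).ch _).trans (add_le_add (s.gdist_ent v) (gdist_shift _ _ _))

lemma labelMap_step (s : State n ks) (u : ZMod (cycLen n ks)) (ε : Bool) :
    labelMap (s.step u ε).K = labelMap s.K * letterVal (labelGraph n) (s.lab u, ε) := by
  obtain ⟨v, h, h'⟩ := s.exists_step_K u ε
  rw [h, nextChamber, labelMap_shift, labelMap_ent, h']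

end State

end CycleRAAG

namespace TraceWord

variable {V : Type*} {G : SimpleGraph V}

lemma shuffle_concat {t : Letter V} {l : List (Letter V)} (h : ∀ r ∈ l, G.Adj r.1 t.1) :
    Shuffle G (t :: l) (l ++ [t]) := by
  induction l with
  | nil => exact .refl _
  | cons s l ih =>
    exact .trans (.swap _ _ _ (h s (by simp)).symm)
      (.cons _ (ih fun r hr => h r (List.mem_cons_of_mem _ hr)))

lemma StackBottom.exists_shuffle {t : Letter V} {B : List (Letter V)} (h : StackBottom G t B) :
    ∃ B', Shuffle G B (B' ++ [t]) := by
  obtain ⟨l₁, l₂, rfl, h⟩ := h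
  refine ⟨l₁ ++ l₂, ?_⟩
  rw [List.append_assoc]
  exact (shuffle_concat h).append_left _

lemma StackBottom.cons_iff {s t : Letter V} {B : List (Letter V)} :
    StackBottom G t (s :: B) ↔ (s = t ∧ ∀ r ∈ B, G.Adj r.1 t.1) ∨ StackBottom G t B := by
  constructor
  · rintro ⟨l₁, l₂, e, h⟩
    cases l₁ with
    | nil =>
      rw [List.nil_append, List.cons.injEq] at e
      obtain ⟨rfl, rfl⟩ := e
      exact .inl ⟨rfl, h⟩
    | cons r l₁ =>
      rw [List.cons_append, List.cons.injEq] at e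
      exact .inr ⟨l₁, l₂, e.2, h⟩
  · rintro (⟨rfl, h⟩ | h)
    · exact ⟨[], B, rfl, h⟩
    · exact h.cons s

end TraceWord

namespace CycleRAAG

open TraceWord

variable {n : ℕ} {ks : List Bool} [hn : Fact (6 < n)]

/-- The state after reading a word, from right to left. -/
noncomputable def run (ks : List Bool) : List (Letter (ZMod (cycLen n ks))) → State n ks
  | [] => ⟨1, 0, true, 0, ∅⟩
  | s :: w => (run ks w).step s.1 s.2

/-- The word in the label group traced out by a word. -/
noncomputable def labelWord (w₀ : List (Letter (ZMod (cycLen n ks)))) :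
    List (Letter (ZMod (cycLen n ks))) → List (Letter (ZMod n × Set (A n)))
  | [] => []
  | s :: w => ((run ks (w ++ w₀)).lab s.1, s.2) :: labelWord w₀ w

lemma good_run (w : List (Letter (ZMod (cycLen n ks)))) : (run ks w).Good := by
  cases w with
  | nil => intro w hw; exact hw.elim
  | cons s w => exact State.good_step _ _ _

lemma run_eq_of_shuffle {w w' : List (Letter (ZMod (cycLen n ks)))}
    (h : Shuffle (cycleGraph (cycLen n ks)) w w') : run ks w = run ks w' := by
  induction h with
  | refl w => rfl
  | cons s _ ih => rw [run, run, ih]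
  | swap s t w h => exact State.step_comm (good_run w) h.symm _ _
  | trans _ _ ih ih' => exact ih.trans ih'

@[simp] lemma labelWord_length (w₀ w : List (Letter (ZMod (cycLen n ks)))) :
    (labelWord w₀ w).length = w.length := by
  induction w with
  | nil => rfl
  | cons s w ih => simp [labelWord, ih]

lemma labelWord_append (w₀ w : List (Letter (ZMod (cycLen n ks)))) :
    labelWord [] (w ++ w₀) = labelWord w₀ w ++ labelWord [] w₀ := by
  induction w with
  | nil => rfl
  | cons s w ih => simp [labelWord, ih]

lemma labelMap_run (w : List (Letter (ZMod (cycLen n ks)))) :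
    labelMap (run ks w).K = labelMap 1 * val (labelGraph n) (labelWord [] w) := by
  induction w with
  | nil => simp [run, labelWord, val]
  | cons s w ih => rw [run, State.labelMap_step, ih, labelWord, val, mul_assoc, List.append_nil]

/-- After reading a letter, only the neighbouring labels are adjacent to its label. -/
lemma adj_of_adj_lab (s : Letter (ZMod (cycLen n ks))) (w : List (Letter (ZMod (cycLen n ks))))
    {u : ZMod (cycLen n ks)}
    (h : (labelGraph n).Adj ((run ks w).lab s.1) ((run ks (s :: w)).lab u)) :
    (cycleGraph (cycLen n ks)).Adj s.1 u := by
  by_contra hu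
  rw [cycle_adj_iff, not_or] at hu
  refine (State.good_step (run ks w) s.1 s.2 s.1 (State.step_S _ _ _).1).2.2 u hu.1 hu.2 ?_
  rwa [State.lab_step_self (good_run w)]

lemma lab_run_cons_adj {s : Letter (ZMod (cycLen n ks))} (w : List (Letter (ZMod (cycLen n ks))))
    {u : ZMod (cycLen n ks)} (h : (cycleGraph (cycLen n ks)).Adj s.1 u) :
    (run ks (s :: w)).lab u = (run ks w).lab u :=
  State.lab_step_adj (good_run w) h _

lemma stackTop_of_labelWord {w : List (Letter (ZMod (cycLen n ks)))} {u : ZMod (cycLen n ks)}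
    {η : Bool} (h : StackTop (labelGraph n) ((run ks w).lab u, η) (labelWord [] w)) :
    StackTop (cycleGraph (cycLen n ks)) (u, η) w := by
  induction w with
  | nil => exact h.elim
  | cons s w ih =>
    rw [labelWord, List.append_nil] at h
    rcases h with h | ⟨h1, h2⟩
    · left
      have h1 : (run ks w).lab s.1 = (run ks (s :: w)).lab u := congrArg Prod.fst h
      have h2 : s.2 = η := congrArg Prod.snd h
      rw [← State.lab_step_self (good_run w) s.1 s.2] at h1
      exact Prod.ext (State.lab_injective _ h1) h2
    · have h3 := adj_of_adj_lab s w h1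
      rw [lab_run_cons_adj w h3] at h2
      exact .inr ⟨h3, ih h2⟩

lemma reduced_labelWord_append {w₀ w : List (Letter (ZMod (cycLen n ks)))}
    (h : Reduced (cycleGraph (cycLen n ks)) (w ++ w₀)) :
    Reduced (labelGraph n) (labelWord w₀ w) := by
  induction w with
  | nil => trivial
  | cons s w ih =>
    rw [List.cons_append] at h
    refine ⟨ih h.1, fun h' => h.2 (stackTop_of_labelWord ?_)⟩
    rw [labelWord_append]
    exact stackTop_append.2 (.inl h')

/-- If the labels of all letters of a word are adjacent to a label, this label has not changed. -/
lemma adj_of_adj_labelWord {w₀ w : List (Letter (ZMod (cycLen n ks)))} {u : ZMod (cycLen n ks)}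
    (h : ∀ r ∈ labelWord w₀ w, (labelGraph n).Adj r.1 ((run ks (w ++ w₀)).lab u)) :
    (∀ r ∈ w, (cycleGraph (cycLen n ks)).Adj r.1 u) ∧
      (run ks (w ++ w₀)).lab u = (run ks w₀).lab u := by
  induction w with
  | nil => exact ⟨by simp, rfl⟩
  | cons s w ih =>
    simp only [labelWord, List.mem_cons, forall_eq_or_imp, List.cons_append] at h ⊢
    have h1 := adj_of_adj_lab s (w ++ w₀) h.1
    rw [lab_run_cons_adj _ h1] at h ⊢
    exact ⟨⟨h1, (ih h.2).1⟩, (ih h.2).2⟩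

lemma stackBottom_of_labelWord {w₀ w : List (Letter (ZMod (cycLen n ks)))}
    {x : Letter (ZMod n × Set (A n))} (h : StackBottom (labelGraph n) x (labelWord w₀ w)) :
    ∃ v, x.1 = (run ks w₀).lab v ∧ StackBottom (cycleGraph (cycLen n ks)) (v, x.2) w := by
  induction w with
  | nil => obtain ⟨l₁, l₂, e, -⟩ := h; simp [labelWord] at e
  | cons s w ih =>
    rw [labelWord, StackBottom.cons_iff] at h
    rcases h with ⟨rfl, h⟩ | h
    · obtain ⟨h1, h2⟩ := adj_of_adj_labelWord h
      exact ⟨s.1, h2, StackBottom.cons_iff.2 (.inl ⟨rfl, h1⟩)⟩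
    · obtain ⟨v, h1, h2⟩ := ih h
      exact ⟨v, h1, h2.cons s⟩

/-- The map from words to chambers does not decrease distances. -/
lemma gdist_le_gdist_labelMap_run (w₀ a b : List (Letter (ZMod (cycLen n ks))))
    (ha : Reduced (cycleGraph (cycLen n ks)) (a ++ w₀))
    (hb : Reduced (cycleGraph (cycLen n ks)) (b ++ w₀)) :
    gdist (cycleGraph (cycLen n ks)) (val _ (a ++ w₀)) (val _ (b ++ w₀)) ≤
      gdist (labelGraph n) (labelMap (run ks (a ++ w₀)).K) (labelMap (run ks (b ++ w₀)).K) := by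
  induction hl : a.length using Nat.strong_induction_on generalizing w₀ a b with
  | _ l ih =>
  by_cases hd : ∃ t, StackBottom (cycleGraph (cycLen n ks)) t a ∧
      StackBottom (cycleGraph (cycLen n ks)) t b
  · obtain ⟨t, h1, h2⟩ := hd
    obtain ⟨a', h1⟩ := h1.exists_shuffle
    obtain ⟨b', h2⟩ := h2.exists_shuffle
    have h3 := h1.length_eq
    have h1' := h1.append_right w₀
    have h2' := h2.append_right w₀
    rw [List.append_assoc, List.singleton_append] at h1' h2'
    rw [h1'.val_eq, h2'.val_eq, run_eq_of_shuffle h1', run_eq_of_shuffle h2']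
    refine ih a'.length ?_ (t :: w₀) a' b' (h1'.reduced ha) (h2'.reduced hb) rfl
    rw [← hl, h3]; simp
  · have h1 : Reduced (labelGraph n) (labelWord w₀ b ++ TraceWord.invRev (labelWord w₀ a)) := by
      refine reduced_append (reduced_labelWord_append hb) (reduced_labelWord_append ha).invRev ?_
      intro t h1 h2
      have h2 := h2.stackBottom_of_invRev
      rw [TraceWord.inv_inv] at h2
      obtain ⟨v, h3, h4⟩ := stackBottom_of_labelWord h1
      obtain ⟨v', h5, h6⟩ := stackBottom_of_labelWord h2
      obtain rfl : v = v' := State.lab_injective _ (h3.symm.trans h5)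
      exact hd ⟨_, h6, h4⟩
    have h2 : gdist (labelGraph n) (labelMap (run ks (a ++ w₀)).K)
        (labelMap (run ks (b ++ w₀)).K) = a.length + b.length := by
      rw [labelMap_run, labelMap_run, gdist_mul_left, labelWord_append, labelWord_append,
        val_append, val_append, gdist_mul_left, gdist, ← val_invRev, ← val_append,
        h1.wordLength_val, List.length_append, invRev_length, labelWord_length, labelWord_length,
        add_comm]
    rw [h2, val_append, val_append, gdist_mul_left, gdist, ← val_invRev, ← val_append]
    refine (wordLength_val_le _).trans ?_
    rw [List.length_append, invRev_length, add_comm]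

/-- The embedding of right-angled Artin groups. -/
noncomputable def embed (ks : List Bool) (g : A (cycLen n ks)) : A n :=
  (run ks (exists_reduced g).choose).K

lemma embed_val {w : List (Letter (ZMod (cycLen n ks)))}
    (h : Reduced (cycleGraph (cycLen n ks)) w) : embed ks (val _ w) = (run ks w).K := by
  have h1 := (exists_reduced (val (cycleGraph (cycLen n ks)) w)).choose_spec
  rw [embed, run_eq_of_shuffle (h1.1.shuffle_of_val_eq h h1.2)]

lemma gdist_le_gdist_embed (g h : A (cycLen n ks)) :
    gdist (cycleGraph (cycLen n ks)) g h ≤ gdist (cycleGraph n) (embed ks g) (embed ks h) := by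
  obtain ⟨a, ha, rfl⟩ := exists_reduced g
  obtain ⟨b, hb, rfl⟩ := exists_reduced h
  rw [embed_val ha, embed_val hb]
  have := gdist_le_gdist_labelMap_run [] a b (by rwa [List.append_nil]) (by rwa [List.append_nil])
  simp only [List.append_nil] at this
  exact this.trans (gdist_labelMap_le _ _)

lemma gdist_embed_le (g h : A (cycLen n ks)) :
    gdist (cycleGraph n) (embed ks g) (embed ks h) ≤
      (1 + (ks.map junctionCost).sum + 2) * gdist (cycleGraph (cycLen n ks)) g h := by
  refine lipschitz_of_step (gdist (cycleGraph n)) gdist_self gdist_triangle (embed ks) _ ?_ g h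
  intro g s
  obtain ⟨w, hw, rfl⟩ := exists_reduced g
  by_cases h : StackTop (cycleGraph (cycLen n ks)) (inv s) w
  · obtain ⟨w', h1⟩ := h.exists_shuffle
    have h2 := h1.reduced hw
    have h3 : val (cycleGraph (cycLen n ks)) w * letterVal _ s = val _ w' := by
      rw [h1.val_eq, val, letterVal_inv, inv_mul_cancel_right]
    rw [h3, h1.val_eq, embed_val h2, embed_val h2.1, gdist_comm]
    exact State.gdist_step _ _ _
  · have h1 : Reduced (cycleGraph (cycLen n ks)) (s :: w) := ⟨hw, h⟩
    have h2 : val (cycleGraph (cycLen n ks)) w * letterVal _ s = val _ (s :: w) := rfl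
    rw [h2, embed_val hw, embed_val h1]
    exact State.gdist_step _ _ _

end CycleRAAG

/-- For `n > 6` and `m = n + p(n-4) + q(n-2)` with `p ≥ 1`, `q ≥ 0`,
there is a `(p+2q+2)`-Lipschitz map `F : A_{C_m} → A_{C_n}` satisfying
`d(F g₁, F g₂) ≥ d(g₁, g₂) - (2p+4q)`; in particular `F` is a quasiisometric embedding. -/
theorem explicit_qie_constants (n p q m : ℕ) (hn : 6 < n) (hp : 1 ≤ p)
    (hm : m = n + p * (n - 4) + q * (n - 2)) :
    ∃ F : RAAG (cycleGraph m) → RAAG (cycleGraph n),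
      (∀ g₁ g₂ : RAAG (cycleGraph m),
        wordDist (raagGen (cycleGraph n)) (F g₁) (F g₂) ≤
          ((p + 2 * q + 2 : ℕ) : ℝ) * wordDist (raagGen (cycleGraph m)) g₁ g₂) ∧
      (∀ g₁ g₂ : RAAG (cycleGraph m),
        wordDist (raagGen (cycleGraph m)) g₁ g₂ - ((2 * p + 4 * q : ℕ) : ℝ) ≤
          wordDist (raagGen (cycleGraph n)) (F g₁) (F g₂)) ∧
      IsQIEWith (wordDist (raagGen (cycleGraph m))) (wordDist (raagGen (cycleGraph n))) F := by
  have : Fact (6 < n) := ⟨hn⟩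
  obtain ⟨p, rfl⟩ : ∃ p', p = p' + 1 := ⟨p - 1, by omega⟩
  let ks : List Bool := List.replicate q false ++ List.replicate p true
  obtain rfl : m = CycleRAAG.cycLen n ks := by
    simp only [hm, CycleRAAG.cycLen, ks, List.map_append, List.map_replicate, List.sum_append,
      List.sum_replicate, CycleRAAG.junctionLength, smul_eq_mul, if_true, Bool.false_eq_true,
      if_false, add_mul]
    omega
  have hcost : 1 + (ks.map CycleRAAG.junctionCost).sum + 2 = p + 1 + 2 * q + 2 := by
    simp only [ks, List.map_append, List.map_replicate, List.sum_append, List.sum_replicate,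
      CycleRAAG.junctionCost, smul_eq_mul, if_true, Bool.false_eq_true, if_false]
    omega
  have upper : ∀ g₁ g₂ : RAAG (cycleGraph (CycleRAAG.cycLen n ks)),
      wordDist (raagGen (cycleGraph n)) (CycleRAAG.embed ks g₁) (CycleRAAG.embed ks g₂) ≤
        ((p + 1 + 2 * q + 2 : ℕ) : ℝ) * wordDist (raagGen (cycleGraph _)) g₁ g₂ := by
    intro g₁ g₂
    have h := CycleRAAG.gdist_embed_le g₁ g₂
    rw [hcost] at h
    refine (Nat.cast_le (α := ℝ).2 h).trans_eq ?_
    rw [Nat.cast_mul]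
    rfl
  have lower : ∀ g₁ g₂ : RAAG (cycleGraph (CycleRAAG.cycLen n ks)),
      wordDist (raagGen (cycleGraph _)) g₁ g₂ ≤
        wordDist (raagGen (cycleGraph n)) (CycleRAAG.embed ks g₁) (CycleRAAG.embed ks g₂) :=
    fun g₁ g₂ => Nat.cast_le.2 (CycleRAAG.gdist_le_gdist_embed g₁ g₂)
  refine ⟨CycleRAAG.embed ks, upper, fun g₁ g₂ => ?_, ((p + 1 + 2 * q + 2 : ℕ) : ℝ), 0, ?_, le_rfl,
    fun g₁ g₂ => ⟨?_, ?_⟩⟩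
  · exact (sub_le_self _ (Nat.cast_nonneg _)).trans (lower g₁ g₂)
  · exact_mod_cast (by omega : 1 ≤ p + 1 + 2 * q + 2)
  · refine le_trans ?_ (lower g₁ g₂)
    rw [sub_zero]
    refine mul_le_of_le_one_left (Nat.cast_nonneg _) ?_
    rw [one_div]
    exact inv_le_one_of_one_le₀ (by exact_mod_cast (by omega : 1 ≤ p + 1 + 2 * q + 2))
  · rw [add_zero]
    exact upper g₁ g₂
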